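/- arXiv:2512.14890 — 3 statements merged into one kernel-verified Lean document; each statement's English description precedes it below -/
import Mathlib

section
/- For every positive integer t there exists a constant d0(t) with the following property: for every tree T on t+1 vertices and every finite simple graph G on n vertices with average degree d = 2|E(G)|/n ≥ d0(t) and minimum degree δ(G) ≥ d/4, the number of injective homomorphisms from T to G is at least n·d(d−1)···(d−t+1). -/
/-- Number of injective graph homomorphisms ("labeled copies") from `T` to `G`. -/
noncomputable def monCount {α β : Type} (T : SimpleGraph α) (G : SimpleGraph β) : ℕ :=
  Nat.card {f : α → β // Function.Injective f ∧ ∀ ⦃u v : α⦄, T.Adj u v → G.Adj (f u) (f v)}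

/-- Average degree `d = 2|E(G)|/n` of a finite graph. -/
noncomputable def avgDeg {β : Type} [Fintype β] (G : SimpleGraph β) : ℝ :=
  2 * (Nat.card G.edgeSet) / (Fintype.card β)

/-- Falling factorial `(x)_t = x(x-1)⋯(x-t+1)` of a real number. -/
noncomputable def fallFact (x : ℝ) (t : ℕ) : ℝ := ∏ i ∈ Finset.range t, (x - (i : ℝ))

set_option linter.unusedVariables false
set_option linter.unusedSectionVars false

open Finset

namespace TreeCount

/-- The bounded surrogate for the logarithm. -/
noncomputable def ell (b r : ℝ) : ℝ := 2 * (1 - r) + b * (1 - r ^ 2) - 2 * b ^ 2 * (1 - r ^ 2) ^ 2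

lemma abs_one_sub_sq {r : ℝ} (h0 : 0 < r) (h2 : r ≤ 2) : |1 - r ^ 2| ≤ 3 * |1 - r| := by
  have : 1 - r ^ 2 = (1 + r) * (1 - r) := by ring
  rw [this, abs_mul, abs_of_pos (by linarith : 0 < 1 + r)]
  exact mul_le_mul_of_nonneg_right (by linarith) (abs_nonneg _)

lemma sq_one_sub_sq {r : ℝ} (h0 : 0 < r) (h2 : r ≤ 2) :
    (1 - r ^ 2) ^ 2 ≤ 9 * (1 - r) ^ 2 := by
  have : (1 - r ^ 2) ^ 2 = (1 + r) ^ 2 * (1 - r) ^ 2 := by ring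
  rw [this]
  exact mul_le_mul_of_nonneg_right (by nlinarith) (sq_nonneg _)

lemma abs_one_sub_le {r : ℝ} (h0 : 0 < r) (h2 : r ≤ 2) : |1 - r| ≤ 1 := by
  rw [abs_le]; constructor <;> linarith

lemma abs_ell_le {b r : ℝ} (hb0 : 0 ≤ b) (hb : b ≤ 1 / 20) (h0 : 0 < r) (h2 : r ≤ 2) :
    |ell b r| ≤ 3 * |1 - r| := by
  have h1 := abs_one_sub_sq h0 h2
  have h3 := abs_one_sub_le h0 h2
  have h4 := sq_one_sub_sq h0 h2
  have h5 : (1 - r) ^ 2 ≤ |1 - r| := by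
    rw [← sq_abs]; nlinarith [abs_nonneg (1 - r)]
  have h6 : |b * (1 - r ^ 2)| ≤ 1 / 20 * (3 * |1 - r|) := by
    rw [abs_mul, abs_of_nonneg hb0]
    exact mul_le_mul hb h1 (abs_nonneg _) (by norm_num)
  have h7 : 2 * b ^ 2 * (1 - r ^ 2) ^ 2 ≤ 2 * (1 / 20) ^ 2 * (9 * |1 - r|) := by
    apply mul_le_mul _ (by linarith) (by positivity) (by positivity)
    have : b ^ 2 ≤ (1 / 20) ^ 2 := by gcongr
    linarith
  have h8 : 0 ≤ 2 * b ^ 2 * (1 - r ^ 2) ^ 2 := by positivity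
  have h9 := abs_nonneg (1 - r)
  obtain ⟨ha, hb⟩ := abs_le.1 h6
  have hc := le_abs_self (1 - r)
  have hd := neg_abs_le (1 - r)
  rw [abs_le]; unfold ell
  constructor <;> nlinarith

lemma ell_ge {b r : ℝ} (hb0 : 0 ≤ b) (hb : b ≤ 1 / 20) (h0 : 0 < r) (h2 : r ≤ 2) :
    1 / 2 * (1 - r) ^ 2 + (1 + b) * (1 - r ^ 2) ≤ ell b r := by
  have h4 := sq_one_sub_sq h0 h2
  have h7 : 2 * b ^ 2 * (1 - r ^ 2) ^ 2 ≤ 2 * (1 / 20) ^ 2 * (9 * (1 - r) ^ 2) := by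
    apply mul_le_mul _ (by linarith) (by positivity) (by positivity)
    have : b ^ 2 ≤ (1 / 20) ^ 2 := by gcongr
    linarith
  unfold ell
  nlinarith [sq_nonneg (1 - r)]

lemma beta_bd {d j : ℝ} (hd : 0 < d) (hj : 0 ≤ j) (h : 40 * j ≤ d) :
    0 ≤ j / (d - j) ∧ j / (d - j) ≤ 1 / 20 := by
  have : 0 < d - j := by linarith
  refine ⟨by positivity, ?_⟩
  rw [div_le_iff₀ this]; linarith

lemma exp_ell_le {d D j r : ℝ} (hd : 0 < d) (hj : 0 ≤ j) (h : 40 * j ≤ d) (h0 : 0 < r)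
    (h2 : r ≤ 2) (hD : D * r ^ 2 = d) :
    Real.exp (ell (j / (d - j)) r) ≤ (D - j) / (d - j) := by
  obtain ⟨hb0, hb⟩ := beta_bd hd hj h
  have hdj : 0 < d - j := by linarith
  set b := j / (d - j) with hbdef
  have hbj : b * (d - j) = j := by rw [hbdef]; field_simp
  have h1 := abs_le.1 (abs_one_sub_sq h0 h2)
  have h3 := abs_one_sub_le h0 h2
  set z := b * (1 - r ^ 2) with hz
  have hz1 : -(1 / 2) ≤ z := by
    have : -3 ≤ 1 - r ^ 2 := by linarith [h1.1]
    nlinarith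
  have hpos : 0 < 1 + z := by linarith
  have e : (D - j) / (d - j) = (r ^ 2)⁻¹ * (1 + z) := by
    have hr : r ^ 2 ≠ 0 := by positivity
    rw [div_eq_iff hdj.ne', ← mul_right_inj' hr]
    have : r ^ 2 * ((r ^ 2)⁻¹ * (1 + z) * (d - j)) = (d - j) + b * (d - j) * (1 - r ^ 2) := by
      rw [hz]; field_simp; 
    rw [this, hbj]; linarith
  rw [e, ← Real.le_log_iff_exp_le (by positivity), Real.log_mul (by positivity) hpos.ne',
    Real.log_inv, Real.log_pow]
  have l1 := Real.log_le_sub_one_of_pos h0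
  have l2 := Real.one_sub_inv_le_log_of_pos hpos
  have l3 : z - 2 * z ^ 2 ≤ 1 - (1 + z)⁻¹ := by
    have : 1 - (1 + z)⁻¹ = z / (1 + z) := by field_simp; ring
    rw [this, le_div_iff₀ hpos]
    nlinarith [mul_nonneg (sq_nonneg z) (by linarith : 0 ≤ 1 + 2 * z)]
  unfold ell
  have : 2 * b ^ 2 * (1 - r ^ 2) ^ 2 = 2 * z ^ 2 := by rw [hz]; ring
  rw [this]
  push_cast
  linarith

lemma prod_diff {ι : Type*} (s : Finset ι) (f g : ι → ℝ) (hf0 : ∀ i ∈ s, 0 ≤ f i)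
    (hf : ∀ i ∈ s, f i ≤ 2) (hg0 : ∀ i ∈ s, 0 ≤ g i) (hg : ∀ i ∈ s, g i ≤ 2) :
    |∏ i ∈ s, f i - ∏ i ∈ s, g i| ≤ 2 ^ #s * ∑ i ∈ s, |f i - g i| := by
  classical
  induction s using Finset.induction_on with
  | empty => simp
  | insert a s ha ih =>
    rw [prod_insert ha, prod_insert ha, sum_insert ha, card_insert_of_notMem ha]
    have ih := ih (fun i hi => hf0 i (mem_insert_of_mem hi)) (fun i hi => hf i (mem_insert_of_mem hi))
      (fun i hi => hg0 i (mem_insert_of_mem hi)) (fun i hi => hg i (mem_insert_of_mem hi))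
    have hp : ∏ i ∈ s, g i ≤ 2 ^ #s :=
      (prod_le_prod (fun i hi => hg0 i (mem_insert_of_mem hi))
        (fun i hi => hg i (mem_insert_of_mem hi))).trans (by rw [prod_const])
    have hp0 : 0 ≤ ∏ i ∈ s, g i := prod_nonneg (fun i hi => hg0 i (mem_insert_of_mem hi))
    have e : f a * ∏ i ∈ s, f i - g a * ∏ i ∈ s, g i
      = f a * (∏ i ∈ s, f i - ∏ i ∈ s, g i) + (f a - g a) * ∏ i ∈ s, g i := by ring
    rw [e]
    have a1 : |f a * (∏ i ∈ s, f i - ∏ i ∈ s, g i)| ≤ 2 * (2 ^ #s * ∑ i ∈ s, |f i - g i|) := by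
      rw [abs_mul, abs_of_nonneg (hf0 a (mem_insert_self _ _))]
      exact mul_le_mul (hf a (mem_insert_self _ _)) ih (abs_nonneg _) (by norm_num)
    have a2 : |(f a - g a) * ∏ i ∈ s, g i| ≤ |f a - g a| * 2 ^ #s := by
      rw [abs_mul, abs_of_nonneg hp0]
      exact mul_le_mul_of_nonneg_left hp (abs_nonneg _)
    have a3 : (0:ℝ) ≤ |f a - g a| * 2 ^ #s := by positivity
    have := abs_add_le (f a * (∏ i ∈ s, f i - ∏ i ∈ s, g i)) ((f a - g a) * ∏ i ∈ s, g i)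
    rw [pow_succ]
    nlinarith

/-- single correction factor -/
noncomputable def phi (b r : ℝ) : ℝ := (1 - b * r ^ 2)⁻¹

lemma phi_bd {b r : ℝ} (hb0 : 0 ≤ b) (hb : b ≤ 1 / 8) (h0 : 0 < r) (h2 : r ≤ 2) :
    1 ≤ phi b r ∧ phi b r ≤ 2 := by
  have h : b * r ^ 2 ≤ 1 / 2 := by nlinarith [mul_nonneg hb0 (sq_nonneg r)]
  have h' : 0 ≤ b * r ^ 2 := by positivity
  unfold phi
  constructor
  · rw [one_le_inv₀ (by linarith)]; linarith
  · rw [inv_le_comm₀ (by linarith) (by norm_num)]; linarith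

lemma phi_diff {b r s : ℝ} (hb0 : 0 ≤ b) (hb : b ≤ 1 / 8) (h0 : 0 < r) (h2 : r ≤ 2)
    (hs0 : 0 < s) (hs2 : s ≤ 2) : phi b r - phi b s = b * (r ^ 2 - s ^ 2) * (phi b r * phi b s) := by
  have h : b * r ^ 2 ≤ 1 / 2 := by nlinarith [mul_nonneg hb0 (sq_nonneg r)]
  have h' : b * s ^ 2 ≤ 1 / 2 := by nlinarith [mul_nonneg hb0 (sq_nonneg s)]
  have : 1 - b * r ^ 2 ≠ 0 := by linarith
  have : 1 - b * s ^ 2 ≠ 0 := by linarith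
  unfold phi
  field_simp
  ring

lemma phi_diff_one {b r : ℝ} (hb0 : 0 ≤ b) (hb : b ≤ 1 / 8) (h0 : 0 < r) (h2 : r ≤ 2) :
    |phi b r - phi b 1| ≤ 12 * b * |1 - r| := by
  rw [phi_diff hb0 hb h0 h2 one_pos one_le_two, abs_mul, abs_mul, abs_of_nonneg hb0]
  obtain ⟨p1, p2⟩ := phi_bd hb0 hb h0 h2
  obtain ⟨q1, q2⟩ := phi_bd hb0 hb one_pos one_le_two
  have hpq : |phi b r * phi b 1| ≤ 4 := by
    rw [abs_of_nonneg (by positivity)]; nlinarith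
  have h1 := abs_one_sub_sq h0 h2
  have : |r ^ 2 - 1 ^ 2| = |1 - r ^ 2| := by rw [abs_sub_comm]; simp
  rw [this]
  calc b * |1 - r ^ 2| * |phi b r * phi b 1| ≤ b * (3 * |1 - r|) * 4 := by gcongr
    _ = _ := by ring

lemma phi_sub_one {b r : ℝ} (hb0 : 0 ≤ b) (hb : b ≤ 1 / 8) (h0 : 0 < r) (h2 : r ≤ 2) :
    |phi b r - 1| ≤ 8 * b := by
  obtain ⟨p1, p2⟩ := phi_bd hb0 hb h0 h2
  have h : b * r ^ 2 ≤ 1 / 2 := by nlinarith [mul_nonneg hb0 (sq_nonneg r)]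
  have e : phi b r - 1 = b * r ^ 2 * phi b r := by
    have : 1 - b * r ^ 2 ≠ 0 := by linarith
    unfold phi; field_simp; ring
  rw [e, abs_of_nonneg (by positivity)]
  calc b * r ^ 2 * phi b r ≤ b * 2 ^ 2 * 2 := by gcongr
    _ = _ := by ring

end TreeCount


namespace TreeCount

lemma sum_update {α β : Type*} [Fintype α] [Fintype β] [DecidableEq α] (a : α)
    (h : (α → β) → ℝ) :
    (Fintype.card β : ℝ) * ∑ ω, h ω = ∑ ω : α → β, ∑ v, h (Function.update ω a v) := by
  classical
  have key : ∀ g : (α → β) → ℝ, ∑ ω, g ω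
      = ∑ v, ∑ w : {j // j ≠ a} → β, g ((Equiv.funSplitAt a β).symm (v, w)) := by
    intro g
    rw [← Fintype.sum_prod_type' (f := fun v w => g ((Equiv.funSplitAt a β).symm (v, w)))]
    exact (Equiv.sum_comp (Equiv.funSplitAt a β).symm g).symm
  rw [key h, key (fun ω => ∑ v, h (Function.update ω a v))]
  have : ∀ (u v : β) (w : {j // j ≠ a} → β),
      Function.update ((Equiv.funSplitAt a β).symm (u, w)) a v
        = (Equiv.funSplitAt a β).symm (v, w) := by
    intro u v w
    ext j
    by_cases hj : j = a
    · subst hj; simp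
    · simp [hj]
  simp only [this]
  rw [sum_const, card_univ, nsmul_eq_mul]
  congr 1
  exact sum_comm

lemma sum_root {α β : Type*} [Fintype α] [Fintype β] [DecidableEq α] (a : α) (f : β → ℝ) (t : ℕ)
    (hcard : Fintype.card α = t + 1) :
    ∑ ω : α → β, f (ω a) = (Fintype.card β : ℝ) ^ t * ∑ v, f v := by
  classical
  have := Equiv.sum_comp (Equiv.funSplitAt a β).symm (fun ω => f (ω a))
  rw [← this, Fintype.sum_prod_type]
  have hc : Fintype.card {j // j ≠ a} = t := by
    rw [Fintype.card_subtype_compl, hcard]; simp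
  simp [hc, mul_sum]

/-- search order of a tree with root `x` -/
structure IsOrder {α : Type*} (T : SimpleGraph α) (t : ℕ) (x : α) (e : ℕ → α) (p : ℕ → ℕ) :
    Prop where
  root : e 0 = x
  ple : ∀ j, j < t → p j ≤ j
  inj : ∀ i j, i ≤ t → j ≤ t → e i = e j → i = j
  adj : ∀ j, j < t → T.Adj (e (p j)) (e (j + 1))

lemma exists_order_aux {α : Type*} [Fintype α] (T : SimpleGraph α) (hT : T.Connected) (x : α)
    (t : ℕ) (ht : t + 1 ≤ Fintype.card α) : ∃ e p, IsOrder T t x e p := by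
  classical
  induction t with
  | zero => exact ⟨fun _ => x, fun _ => 0, rfl, by simp, by intros; omega, by simp⟩
  | succ t ih =>
    obtain ⟨e, p, h⟩ := ih (by omega)
    set S : Finset α := (range (t + 1)).image e with hS
    have hSc : #S ≤ t + 1 := by simpa using card_image_le (s := range (t + 1)) (f := e)
    obtain ⟨y, hy⟩ : ∃ y, y ∉ S := by
      by_contra! hc
      have : S = univ := eq_univ_of_forall hc
      rw [this, card_univ] at hSc; omega
    have hx : x ∈ S := by
      rw [hS, mem_image]; exact ⟨0, by simp, h.root⟩
    obtain ⟨w⟩ := hT.preconnected x y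
    obtain ⟨dd, -, h1, h2⟩ := w.exists_boundary_dart (S : Set α) (by simpa using hx) (by simpa using hy)
    have h1' : dd.fst ∈ S := by simpa using h1
    have h2' : dd.snd ∉ S := by simpa using h2
    rw [hS, mem_image] at h1'
    obtain ⟨k, hk, hke⟩ := h1'
    rw [mem_range] at hk
    have hne : ∀ i, i ≤ t → e i ≠ dd.snd := by
      intro i hi he
      apply h2'
      rw [hS, mem_image]; exact ⟨i, by simp; omega, he⟩
    refine ⟨Function.update e (t + 1) dd.snd, Function.update p t k, ?_, ?_, ?_, ?_⟩
    · simpa using h.root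
    · intro j hj
      by_cases hjt : j = t
      · subst hjt; simp; omega
      · rw [Function.update_of_ne hjt]; exact h.ple j (by omega)
    · intro i j hi hj
      by_cases hi' : i = t + 1 <;> by_cases hj' : j = t + 1
      · omega
      · subst hi'; rw [Function.update_self, Function.update_of_ne hj']
        intro he; exact absurd he.symm (hne j (by omega))
      · subst hj'; rw [Function.update_self, Function.update_of_ne hi']
        intro he; exact absurd he (hne i (by omega))
      · rw [Function.update_of_ne hi', Function.update_of_ne hj']
        exact h.inj i j (by omega) (by omega)
    · intro j hj
      by_cases hjt : j = t
      · subst hjt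
        rw [Function.update_self, Function.update_self, Function.update_of_ne (by omega), hke]
        exact dd.adj
      · have := h.ple j (by omega)
        rw [Function.update_of_ne hjt, Function.update_of_ne (by omega),
          Function.update_of_ne (by omega)]
        exact h.adj j (by omega)

section
variable {α : Type*} [Fintype α] {T : SimpleGraph α} {t : ℕ} {x : α} {e : ℕ → α} {p : ℕ → ℕ}

lemma IsOrder.surj (h : IsOrder T t x e p) (hc : Fintype.card α = t + 1) (a : α) :
    ∃ i, i ≤ t ∧ e i = a := by
  classical
  have : (range (t + 1)).image e = univ := by
    rw [← card_eq_iff_eq_univ, card_image_of_injOn, hc]; simp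
    intro i hi j hj hij
    simp at hi hj
    exact h.inj i j (by omega) (by omega) hij
  have ha : a ∈ (range (t + 1)).image e := by rw [this]; exact mem_univ _
  rw [mem_image] at ha
  obtain ⟨i, hi, he⟩ := ha
  exact ⟨i, by simp at hi; omega, he⟩

lemma IsOrder.edge_inj (h : IsOrder T t x e p) (i j : ℕ) (hi : i < t) (hj : j < t)
    (hij : s(e (p i), e (i + 1)) = s(e (p j), e (j + 1))) : i = j := by
  have a := h.ple i hi
  have b := h.ple j hj
  rw [Sym2.eq_iff] at hij
  rcases hij with ⟨_, h2⟩ | ⟨h1, h2⟩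
  · have := h.inj _ _ (by omega) (by omega) h2; omega
  · have h1 := h.inj _ _ (by omega) (by omega) h1
    have h2 := h.inj _ _ (by omega) (by omega) h2
    omega

open Classical in
lemma IsOrder.edges (h : IsOrder T t x e p) (hT : T.IsTree) (hc : Fintype.card α = t + 1) :
    (range t).image (fun j => s(e (p j), e (j + 1))) = T.edgeFinset := by
  apply eq_of_subset_of_card_le
  · intro z hz
    rw [mem_image] at hz
    obtain ⟨j, hj, rfl⟩ := hz
    rw [mem_range] at hj
    rw [SimpleGraph.mem_edgeFinset, SimpleGraph.mem_edgeSet]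
    exact h.adj j hj
  · have := hT.card_edgeFinset
    rw [card_image_of_injOn]
    · simp; omega
    · intro i hi j hj hij
      simp at hi hj
      exact h.edge_inj i j hi hj hij

open Classical in
/-- The product over parents, in terms of order independent quantities. -/
lemma IsOrder.prod_parent (h : IsOrder T t x e p) (hT : T.IsTree) (hc : Fintype.card α = t + 1)
    (g : α → ℝ) (hg : ∀ a, g a ≠ 0) :
    g x * ∏ j ∈ range t, (g (e (p j)))⁻¹
      = (∏ a, g a) * (∏ z ∈ T.edgeFinset, Sym2.lift ⟨fun a b => g a * g b, fun a b => mul_comm _ _⟩ z)⁻¹ := by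
  rw [← h.edges hT hc, prod_image]
  · simp only [Sym2.lift_mk, prod_mul_distrib, mul_inv, prod_inv_distrib]
    have e1 : ∏ a, g a = g x * ∏ j ∈ range t, g (e (j + 1)) := by
      have : (univ : Finset α) = (range (t + 1)).image e := by
        symm; rw [eq_univ_iff_forall]
        intro a
        obtain ⟨i, hi, he⟩ := h.surj hc a
        rw [mem_image]; exact ⟨i, by simp; omega, he⟩
      rw [this, prod_image, prod_range_succ', h.root, mul_comm]
      intro i hi j hj hij
      simp at hi hj
      exact h.inj i j (by omega) (by omega) hij
    have h2 : ∏ j ∈ range t, g (e (j + 1)) ≠ 0 := prod_ne_zero_iff.2 fun _ _ => hg _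
    have h3 : ∏ j ∈ range t, g (e (p j)) ≠ 0 := prod_ne_zero_iff.2 fun _ _ => hg _
    rw [e1]
    field_simp
  · intro i hi j hj hij
    simp at hi hj
    exact h.edge_inj i j hi hj hij

variable {β : Type*} [Fintype β]

lemma upd_ne [DecidableEq α] (h : IsOrder T t x e p) {i k : ℕ} (hi : i ≤ k) (hk : k < t) (ω : α → β) (v : β) :
    Function.update ω (e (k + 1)) v (e i) = ω (e i) := by
  rw [Function.update_of_ne]
  intro he
  have := h.inj _ _ (by omega) (by omega) he
  omega

open Classical in
/-- Lower bound for the embedding walk. -/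
lemma IsOrder.lower (h : IsOrder T t x e p) (hT : T.IsTree) (hc : Fintype.card α = t + 1)
    (G : SimpleGraph β) (hn : 0 < Fintype.card β)
    (hdeg : ∀ v, t < G.degree v) (f : β → ℝ) (hf : ∀ v, 0 ≤ f v) :
    ∑ v, f v ≤ ∑ ω ∈ univ.filter (fun ω : α → β => Function.Injective ω ∧
      ∀ ⦃u v : α⦄, T.Adj u v → G.Adj (ω u) (ω v)),
      f (ω x) * ∏ j ∈ range t, ((G.degree (ω (e (p j))) : ℝ) - j)⁻¹ := by
  set A : ℕ → (α → β) → ℝ := fun j ω =>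
    if G.Adj (ω (e (p j))) (ω (e (j + 1))) ∧ ∀ i, i ≤ j → ω (e i) ≠ ω (e (j + 1)) then
      ((G.degree (ω (e (p j))) : ℝ) - j)⁻¹ else 0 with hA
  have hpos : ∀ j, j < t → ∀ v, (0:ℝ) < (G.degree v : ℝ) - j := by
    intro j hj v
    have := hdeg v
    have : (j : ℝ) < G.degree v := by exact_mod_cast (by omega)
    linarith
  have hA0 : ∀ j, j < t → ∀ ω, 0 ≤ A j ω := by
    intro j hj ω
    simp only [hA]; split_ifs
    · exact (inv_pos.2 (hpos j hj _)).le
    · exact le_rfl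
  have hstep : ∀ k, k < t → ∑ ω, f (ω x) * ∏ j ∈ range k, A j ω
      ≤ (Fintype.card β : ℝ) * ∑ ω, f (ω x) * ∏ j ∈ range (k + 1), A j ω := by
    intro k hk
    rw [sum_update (e (k + 1))]
    apply sum_le_sum
    intro ω _
    have e1 : ∀ v, f (Function.update ω (e (k + 1)) v x) *
        ∏ j ∈ range (k + 1), A j (Function.update ω (e (k + 1)) v)
        = (f (ω x) * ∏ j ∈ range k, A j ω) * A k (Function.update ω (e (k + 1)) v) := by
      intro v
      rw [prod_range_succ, ← mul_assoc]
      congr 2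
      · rw [← h.root, upd_ne h (by omega) hk]
      · apply prod_congr rfl
        intro j hj
        rw [mem_range] at hj
        have := h.ple j (by omega)
        simp only [hA]
        rw [upd_ne h (by omega : p j ≤ k) hk, upd_ne h (by omega : j + 1 ≤ k) hk]
        have : ∀ i, i ≤ j → Function.update ω (e (k + 1)) v (e i) = ω (e i) := fun i hi =>
          upd_ne h (by omega) hk ω v
        congr 1
        simp +contextual [this]
    simp only [e1]
    rw [← mul_sum]
    apply le_mul_of_one_le_right
    · apply mul_nonneg (hf _) (prod_nonneg _)
      intro j hj; rw [mem_range] at hj; exact hA0 j (by omega) ω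
    · have e2 : ∀ v, A k (Function.update ω (e (k + 1)) v)
          = if G.Adj (ω (e (p k))) v ∧ ∀ i, i ≤ k → ω (e i) ≠ v then
            ((G.degree (ω (e (p k))) : ℝ) - k)⁻¹ else 0 := by
        intro v
        have := h.ple k hk
        simp only [hA]
        rw [upd_ne h (by omega : p k ≤ k) hk, Function.update_self]
        have : ∀ i, i ≤ k → Function.update ω (e (k + 1)) v (e i) = ω (e i) := fun i hi =>
          upd_ne h (by omega) hk ω v
        congr 1
        simp +contextual [this]
      simp only [e2]
      rw [← sum_filter, sum_const, nsmul_eq_mul, ← div_eq_mul_inv, le_div_iff₀ (hpos k hk _), one_mul]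
      set S : Finset β := ((range (k + 1)).image (fun i => ω (e i))).erase (ω (e (p k))) with hS
      have hsub : G.neighborFinset (ω (e (p k))) \ S ⊆
          univ.filter (fun v => G.Adj (ω (e (p k))) v ∧ ∀ i, i ≤ k → ω (e i) ≠ v) := by
        intro v hv
        rw [mem_sdiff, SimpleGraph.mem_neighborFinset] at hv
        rw [mem_filter]
        refine ⟨mem_univ _, hv.1, ?_⟩
        intro i hi hiv
        apply hv.2
        rw [hS, mem_erase, mem_image]
        exact ⟨hv.1.ne', i, by simp; omega, hiv⟩
      have hSc : #S ≤ k := by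
        rw [hS, card_erase_of_mem]
        · have := card_image_le (s := range (k + 1)) (f := fun i => ω (e i))
          simp at this; omega
        · have := h.ple k hk
          rw [mem_image]; exact ⟨p k, by simp; omega, rfl⟩
      have h1 := card_le_card hsub
      have h2 := le_card_sdiff S (G.neighborFinset (ω (e (p k))))
      rw [SimpleGraph.card_neighborFinset_eq_degree] at h2
      have h3 : G.degree (ω (e (p k))) ≤ 
        #(univ.filter (fun v => G.Adj (ω (e (p k))) v ∧ ∀ i, i ≤ k → ω (e i) ≠ v)) + k := by omega
      have h4 : (G.degree (ω (e (p k))) : ℝ) ≤ 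
        (#(univ.filter (fun v => G.Adj (ω (e (p k))) v ∧ ∀ i, i ≤ k → ω (e i) ≠ v)) : ℝ) + k := by
        exact_mod_cast h3
      linarith
  have hn' : (0:ℝ) < Fintype.card β := by exact_mod_cast hn
  have hk : ∀ k, k ≤ t → ∑ ω : α → β, f (ω x) ≤ (Fintype.card β : ℝ) ^ k *
      ∑ ω, f (ω x) * ∏ j ∈ range k, A j ω := by
    intro k
    induction k with
    | zero => intro _; simp
    | succ k ih =>
      intro hk
      refine (ih (by omega)).trans ?_
      rw [pow_succ, mul_assoc]
      exact mul_le_mul_of_nonneg_left (hstep k (by omega)) (by positivity)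
  have := hk t le_rfl
  rw [sum_root x f t hc] at this
  have h5 := le_of_mul_le_mul_left this (by positivity)
  refine h5.trans ?_
  rw [sum_filter]
  apply sum_le_sum
  intro ω _
  split_ifs with hω
  · apply mul_le_mul_of_nonneg_left _ (hf _)
    apply prod_le_prod
    · intro j hj; exact hA0 j (by simpa using hj) ω
    · intro j hj
      rw [mem_range] at hj
      simp only [hA]; split_ifs
      · exact le_rfl
      · exact (inv_pos.2 (hpos j hj _)).le
  · apply le_of_eq
    by_contra hne
    apply hω
    have hne2 := right_ne_zero_of_mul hne
    rw [prod_ne_zero_iff] at hne2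
    have hall : ∀ j, j < t → G.Adj (ω (e (p j))) (ω (e (j + 1))) ∧
        ∀ i, i ≤ j → ω (e i) ≠ ω (e (j + 1)) := by
      intro j hj
      by_contra hcon
      apply hne2 j (by simpa using hj)
      simp only [hA]
      rw [if_neg hcon]
    constructor
    · intro a b hab
      obtain ⟨i, hi, rfl⟩ := h.surj hc a
      obtain ⟨j, hj, rfl⟩ := h.surj hc b
      rcases lt_trichotomy i j with hij | hij | hij
      · obtain ⟨j, rfl⟩ : ∃ k, j = k + 1 := ⟨j - 1, by omega⟩
        exact absurd hab ((hall j (by omega)).2 i (by omega))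
      · rw [hij]
      · obtain ⟨i, rfl⟩ : ∃ k, i = k + 1 := ⟨i - 1, by omega⟩
        exact absurd hab.symm ((hall i (by omega)).2 j (by omega))
    · intro u v huv
      have : s(u, v) ∈ T.edgeFinset := by
        rw [SimpleGraph.mem_edgeFinset]; exact huv
      rw [← h.edges hT hc, mem_image] at this
      obtain ⟨j, hj, hje⟩ := this
      rw [mem_range] at hj
      rw [Sym2.eq_iff] at hje
      rcases hje with ⟨h1, h2⟩ | ⟨h1, h2⟩
      · rw [← h1, ← h2]; exact (hall j hj).1
      · rw [← h1, ← h2]; exact (hall j hj).1.symm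

open Classical in
/-- Upper bound from the homomorphism walk. -/
lemma IsOrder.upper (h : IsOrder T t x e p) (hc : Fintype.card α = t + 1)
    (G : SimpleGraph β) (hn : 0 < Fintype.card β)
    (hdeg : ∀ v, t < G.degree v) (f : β → ℝ) (hf : ∀ v, 0 ≤ f v) :
    ∑ ω ∈ univ.filter (fun ω : α → β => Function.Injective ω ∧
      ∀ ⦃u v : α⦄, T.Adj u v → G.Adj (ω u) (ω v)),
      f (ω x) * ∏ j ∈ range t, (G.degree (ω (e (p j))) : ℝ)⁻¹ ≤ ∑ v, f v := by
  set A : ℕ → (α → β) → ℝ := fun j ω =>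
    if G.Adj (ω (e (p j))) (ω (e (j + 1))) then
      (G.degree (ω (e (p j))) : ℝ)⁻¹ else 0 with hA
  have hpos : ∀ v, (0:ℝ) < (G.degree v : ℝ) := by
    intro v
    have := hdeg v
    exact_mod_cast (by omega)
  have hA0 : ∀ j, j < t → ∀ ω, 0 ≤ A j ω := by
    intro j hj ω
    simp only [hA]; split_ifs
    · exact (inv_pos.2 (hpos _)).le
    · exact le_rfl
  have hstep : ∀ k, k < t → (Fintype.card β : ℝ) * ∑ ω, f (ω x) * ∏ j ∈ range (k + 1), A j ω
      = ∑ ω, f (ω x) * ∏ j ∈ range k, A j ω := by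
    intro k hk
    rw [sum_update (e (k + 1))]
    apply sum_congr rfl
    intro ω _
    have e1 : ∀ v, f (Function.update ω (e (k + 1)) v x) *
        ∏ j ∈ range (k + 1), A j (Function.update ω (e (k + 1)) v)
        = (f (ω x) * ∏ j ∈ range k, A j ω) * A k (Function.update ω (e (k + 1)) v) := by
      intro v
      rw [prod_range_succ, ← mul_assoc]
      congr 2
      · rw [← h.root, upd_ne h (by omega) hk]
      · apply prod_congr rfl
        intro j hj
        rw [mem_range] at hj
        have := h.ple j (by omega)
        simp only [hA]
        rw [upd_ne h (by omega : p j ≤ k) hk, upd_ne h (by omega : j + 1 ≤ k) hk]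
    simp only [e1]
    rw [← mul_sum]
    have e2 : ∀ v, A k (Function.update ω (e (k + 1)) v)
          = if G.Adj (ω (e (p k))) v then (G.degree (ω (e (p k))) : ℝ)⁻¹ else 0 := by
      intro v
      have := h.ple k hk
      simp only [hA]
      rw [upd_ne h (by omega : p k ≤ k) hk, Function.update_self]
    simp only [e2]
    rw [← sum_filter, sum_const, nsmul_eq_mul, ← SimpleGraph.neighborFinset_eq_filter,
      SimpleGraph.card_neighborFinset_eq_degree, mul_inv_cancel₀ (hpos _).ne', mul_one]
  have hn' : (0:ℝ) < Fintype.card β := by exact_mod_cast hn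
  have hk : ∀ k, k ≤ t → ∑ ω : α → β, f (ω x) = (Fintype.card β : ℝ) ^ k *
      ∑ ω, f (ω x) * ∏ j ∈ range k, A j ω := by
    intro k
    induction k with
    | zero => intro _; simp
    | succ k ih =>
      intro hk
      rw [ih (by omega), pow_succ, mul_assoc, hstep k (by omega)]
  have := hk t le_rfl
  rw [sum_root x f t hc] at this
  have h5 := mul_left_cancel₀ (by positivity) this
  rw [h5, sum_filter]
  apply sum_le_sum
  intro ω _
  split_ifs with hω
  · apply mul_le_mul_of_nonneg_left _ (hf _)
    apply le_of_eq
    apply prod_congr rfl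
    intro j hj
    rw [mem_range] at hj
    simp only [hA]
    rw [if_pos (hω.2 (h.adj j hj))]
  · apply mul_nonneg (hf _) (prod_nonneg _)
    intro j hj; exact hA0 j (by simpa using hj) ω

end

end TreeCount
namespace TreeCount

lemma assembly {α β : Type*} [Fintype α] [Fintype β] (M : Finset (α → β)) (Q : (α → β) → ℝ)
    (hQ0 : ∀ ω, 0 ≤ Q ω) (ρ : α → (α → β) → ℝ) (π θ : β → ℝ) (hθ : ∀ v, 0 ≤ θ v)
    (hπ0 : ∀ v, 0 ≤ π v)
    (L : ℕ → β → ℝ) (c : α → ℕ → α) (m t : ℕ) (Ψ C1 C2 : ℝ) (hΨ : Ψ = ∑ v, π v * θ v ^ 2)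
    (hC1 : 0 ≤ C1) 
    (hρ : ∀ x y ω, |ρ x ω - ρ y ω| ≤
      C1 * (∑ i ∈ range t, θ (ω (c x i)) + ∑ i ∈ range t, θ (ω (c y i))))
    (hρ1 : ∀ x ω, ρ x ω ≤ 1 + C2) (hC2 : 0 ≤ C2)
    (hA : ∀ x (f : β → ℝ), (∀ v, 0 ≤ f v) → ∑ v, π v * f v ≤ ∑ ω ∈ M, Q ω * ρ x ω * f (ω x))
    (hB : ∀ x (f : β → ℝ), (∀ v, 0 ≤ f v) → ∑ ω ∈ M, Q ω * f (ω x) ≤ ∑ v, π v * f v)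
    (hL : ∀ j v, j < m → |L j v| ≤ 3 * θ v)
    (hE : ∀ j, j < m → Ψ / 2 ≤ ∑ v, π v * L j v) (hπ : ∑ v, π v = 1) :
    (Fintype.card α : ℝ) * (1 + m / 2 * Ψ - C2 * (9 * (Fintype.card α) ^ 2 * m ^ 2) * Ψ
        - m * (6 * t * C1) * Ψ)
      ≤ ∑ x, ∑ ω ∈ M, Q ω * ρ x ω * (1 + ∑ j ∈ range m, L j (ω (c x (j + 1)))) := by
  classical
  set N : ℝ := (Fintype.card α : ℝ) with hN
  have hΨ0 : 0 ≤ Ψ := by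
    rw [hΨ]; exact sum_nonneg fun v _ => mul_nonneg (hπ0 v) (sq_nonneg _)
  -- step 1: cross terms
  have hB2 : ∀ z, ∑ ω ∈ M, Q ω * θ (ω z) ^ 2 ≤ Ψ := by
    intro z; rw [hΨ]; exact hB z (fun v => θ v ^ 2) (fun v => sq_nonneg _)
  have hBB : ∀ z y, ∑ ω ∈ M, Q ω * (θ (ω z) * θ (ω y)) ≤ Ψ := by
    intro z y
    have h1 := hB2 z
    have h2 := hB2 y
    have : ∑ ω ∈ M, Q ω * (θ (ω z) * θ (ω y)) ≤
        ∑ ω ∈ M, (Q ω * θ (ω z) ^ 2 + Q ω * θ (ω y) ^ 2) / 2 := by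
      apply sum_le_sum
      intro ω _
      nlinarith [mul_nonneg (hQ0 ω) (sq_nonneg (θ (ω z) - θ (ω y)))]
    rw [← sum_div, sum_add_distrib] at this
    linarith
  have hcross : ∀ x y j, j < m → 
      ∑ ω ∈ M, Q ω * ρ y ω * L j (ω y) - 6 * t * C1 * Ψ ≤ ∑ ω ∈ M, Q ω * ρ x ω * L j (ω y) := by
    intro x y j hj
    have h1 : ∑ ω ∈ M, (Q ω * ρ y ω * L j (ω y) - Q ω * ρ x ω * L j (ω y)) ≤
        ∑ ω ∈ M, 3 * C1 * (∑ i ∈ range t, Q ω * (θ (ω (c x i)) * θ (ω y))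
          + ∑ i ∈ range t, Q ω * (θ (ω (c y i)) * θ (ω y))) := by
      apply sum_le_sum
      intro ω _
      have e : Q ω * ρ y ω * L j (ω y) - Q ω * ρ x ω * L j (ω y)
        = Q ω * ((ρ y ω - ρ x ω) * L j (ω y)) := by ring
      have e2 : 3 * C1 * (∑ i ∈ range t, Q ω * (θ (ω (c x i)) * θ (ω y))
          + ∑ i ∈ range t, Q ω * (θ (ω (c y i)) * θ (ω y)))
          = Q ω * ((C1 * (∑ i ∈ range t, θ (ω (c x i)) + ∑ i ∈ range t, θ (ω (c y i))))
            * (3 * θ (ω y))) := by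
        rw [← mul_sum, ← mul_sum, ← sum_mul, ← sum_mul]; ring
      rw [e, e2]
      apply mul_le_mul_of_nonneg_left _ (hQ0 ω)
      refine (le_abs_self _).trans ?_
      rw [abs_mul, abs_sub_comm]
      apply mul_le_mul (hρ x y ω) (hL j _ hj) (abs_nonneg _)
      exact (abs_nonneg _).trans (hρ x y ω)
    have h2 : ∑ ω ∈ M, 3 * C1 * (∑ i ∈ range t, Q ω * (θ (ω (c x i)) * θ (ω y))
          + ∑ i ∈ range t, Q ω * (θ (ω (c y i)) * θ (ω y))) ≤ 3 * C1 * (t * Ψ + t * Ψ) := by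
      rw [← mul_sum, sum_add_distrib, sum_comm, sum_comm (s := M)]
      apply mul_le_mul_of_nonneg_left _ (by positivity)
      apply add_le_add
      · refine (sum_le_sum fun i _ => hBB (c x i) y).trans ?_
        simp
      · refine (sum_le_sum fun i _ => hBB (c y i) y).trans ?_
        simp
    rw [sum_sub_distrib] at h1
    linarith
  -- step 2: regroup
  set F : α → β → ℝ := fun y v => ∑ x, ∑ j ∈ range m, if c x (j + 1) = y then L j v else 0 with hF
  have hFb : ∀ y v, |F y v| ≤ 3 * N * m * θ v := by
    intro y v
    refine (abs_sum_le_sum_abs _ _).trans ?_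
    have : ∀ x ∈ (univ : Finset α), |∑ j ∈ range m, if c x (j + 1) = y then L j v else 0|
        ≤ m * (3 * θ v) := by
      intro x _
      refine (abs_sum_le_sum_abs _ _).trans ?_
      refine (sum_le_sum (g := fun _ => 3 * θ v) fun j hj => ?_).trans (by simp)
      split_ifs
      · exact hL j v (by simpa using hj)
      · have := hθ v; simp; linarith
    refine (sum_le_sum this).trans ?_
    simp [hN]; apply le_of_eq; ring
  have hroot : ∀ y, 1 + ∑ v, π v * F y v - C2 * (9 * N ^ 2 * m ^ 2) * Ψ ≤
      ∑ ω ∈ M, Q ω * ρ y ω * (1 + F y (ω y)) := by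
    intro y
    set B := 3 * N * m with hBd
    have hB0 : 0 ≤ B := by positivity
    have h1 := hA y (fun v => 1 + F y v + B ^ 2 * θ v ^ 2) (by
      intro v
      have := (abs_le.1 (hFb y v)).1
      nlinarith [sq_nonneg (B * θ v - 1 / 2)])
    have h2 := hB y (fun v => B ^ 2 * θ v ^ 2) (by intro v; positivity)
    have h3 : ∑ ω ∈ M, Q ω * ρ y ω * (B ^ 2 * θ (ω y) ^ 2) ≤
        (1 + C2) * ∑ ω ∈ M, Q ω * (B ^ 2 * θ (ω y) ^ 2) := by
      rw [mul_sum]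
      apply sum_le_sum
      intro ω _
      have : 0 ≤ Q ω * (B ^ 2 * θ (ω y) ^ 2) := mul_nonneg (hQ0 ω) (by positivity)
      have := mul_le_mul_of_nonneg_right (hρ1 y ω) this
      linarith
    have e1 : ∑ v, π v * (1 + F y v + B ^ 2 * θ v ^ 2) = 1 + ∑ v, π v * F y v + B ^ 2 * Ψ := by
      have e0 : ∀ v, π v * (1 + F y v + B ^ 2 * θ v ^ 2)
          = π v + π v * F y v + B ^ 2 * (π v * θ v ^ 2) := by intro v; ring
      simp only [e0]
      rw [sum_add_distrib, sum_add_distrib, hπ, ← mul_sum, ← hΨ]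
    have e2 : ∑ v, π v * (B ^ 2 * θ v ^ 2) = B ^ 2 * Ψ := by
      rw [hΨ, mul_sum]
      apply sum_congr rfl; intro v _; ring
    have e3 : ∑ ω ∈ M, Q ω * ρ y ω * (1 + F y (ω y) + B ^ 2 * θ (ω y) ^ 2)
      = ∑ ω ∈ M, Q ω * ρ y ω * (1 + F y (ω y)) + ∑ ω ∈ M, Q ω * ρ y ω * (B ^ 2 * θ (ω y) ^ 2) := by
      rw [← sum_add_distrib]; apply sum_congr rfl; intro v _; ring
    rw [e1, e3] at h1
    rw [e2] at h2
    have h4 := mul_le_mul_of_nonneg_left h2 (by linarith : 0 ≤ 1 + C2)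
    have : B ^ 2 = 9 * N ^ 2 * m ^ 2 := by rw [hBd]; ring
    rw [← this]
    linarith
  have hregroup : ∀ g : α → ℕ → α → ℝ, ∑ y, ∑ x, ∑ j ∈ range m, (if c x (j + 1) = y then g x j y else 0)
      = ∑ x, ∑ j ∈ range m, g x j (c x (j + 1)) := by
    intro g
    rw [sum_comm]
    apply sum_congr rfl; intro x _
    rw [sum_comm]
    apply sum_congr rfl; intro j _
    simp
  have hsum1 : ∑ y, ∑ v, π v * F y v = ∑ x : α, ∑ j ∈ range m, ∑ v, π v * L j v := by
    rw [← hregroup (fun x j y => ∑ v, π v * L j v)]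
    apply sum_congr rfl; intro y _
    simp only [hF, mul_sum]
    rw [sum_comm]
    apply sum_congr rfl; intro x _
    rw [sum_comm]
    apply sum_congr rfl; intro j _
    split_ifs <;> simp
  have hsum2 : ∑ y, ∑ ω ∈ M, Q ω * ρ y ω * F y (ω y) =
      ∑ x, ∑ j ∈ range m, ∑ ω ∈ M, Q ω * ρ (c x (j + 1)) ω * L j (ω (c x (j + 1))) := by
    rw [← hregroup (fun x j y => ∑ ω ∈ M, Q ω * ρ y ω * L j (ω y))]
    apply sum_congr rfl; intro y _
    simp only [hF, mul_sum]
    rw [sum_comm]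
    apply sum_congr rfl; intro x _
    rw [sum_comm]
    apply sum_congr rfl; intro j _
    split_ifs <;> simp
  have hI : N * (m * (Ψ / 2)) ≤ ∑ x : α, ∑ j ∈ range m, ∑ v, π v * L j v := by
    have : ∀ x ∈ (univ : Finset α), (m * (Ψ / 2)) ≤ ∑ j ∈ range m, ∑ v, π v * L j v := by
      intro x _
      refine le_trans (by simp) (sum_le_sum (f := fun _ => Ψ / 2) fun j hj => hE j (by simpa using hj))
    refine le_trans (by simp [hN]) (sum_le_sum this)
  have hII : ∑ x, ∑ j ∈ range m, ∑ ω ∈ M, Q ω * ρ (c x (j + 1)) ω * L j (ω (c x (j + 1)))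
      - N * (m * (6 * t * C1 * Ψ)) ≤
      ∑ x, ∑ j ∈ range m, ∑ ω ∈ M, Q ω * ρ x ω * L j (ω (c x (j + 1))) := by
    have := sum_le_sum (s := (univ : Finset α)) fun x _ => sum_le_sum (s := range m) fun j hj =>
      hcross x (c x (j + 1)) j (by simpa using hj)
    refine le_trans (le_of_eq ?_) this
    simp only [sum_sub_distrib]
    simp [hN]
  have hIII : ∑ x, ∑ ω ∈ M, Q ω * ρ x ω * (1 + ∑ j ∈ range m, L j (ω (c x (j + 1))))
      = ∑ x, ∑ ω ∈ M, Q ω * ρ x ω +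
        ∑ x, ∑ j ∈ range m, ∑ ω ∈ M, Q ω * ρ x ω * L j (ω (c x (j + 1))) := by
    rw [← sum_add_distrib]
    apply sum_congr rfl; intro x _
    rw [sum_comm, ← sum_add_distrib]
    apply sum_congr rfl; intro ω _
    rw [mul_add, mul_sum, mul_one]
  have hIV := sum_le_sum (s := (univ : Finset α)) fun y _ => hroot y
  have e4 : ∑ y, ∑ ω ∈ M, Q ω * ρ y ω * (1 + F y (ω y)) =
      ∑ x, ∑ ω ∈ M, Q ω * ρ x ω + ∑ y, ∑ ω ∈ M, Q ω * ρ y ω * F y (ω y) := by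
    rw [← sum_add_distrib]
    apply sum_congr rfl; intro x _
    rw [← sum_add_distrib]
    apply sum_congr rfl; intro ω _
    ring
  rw [e4, hsum2, sum_sub_distrib, sum_add_distrib, hsum1] at hIV
  simp only [sum_const, card_univ, nsmul_eq_mul, mul_one] at hIV hI
  rw [← hN] at hIV
  rw [hIII]
  linarith

noncomputable def dZero (t : ℕ) : ℝ :=
  40 * t + 18 * (2 ^ t * 8 * t ^ 2) * (t + 1) ^ 2 * t + 12 * t * (2 ^ t * 12 * t)

lemma core {α β : Type*} [Fintype α] [Fintype β] (m t : ℕ) (htm : t = m + 1)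
    (hα : Fintype.card α = t + 1) (M : Finset (α → β)) (D : β → ℝ) (d n : ℝ) (hn : 0 < n)
    (hd : dZero t ≤ d) (hmin : ∀ v, d / 4 ≤ D v) (hsum : ∑ v, D v = n * d)
    (hcard : (Fintype.card β : ℝ) = n) (c : α → ℕ → α) (hc0 : ∀ x, c x 0 = x)
    (Q : (α → β) → ℝ)
    (hQ : ∀ x ω, Q ω = D (ω x) / (n * d) * ∏ j ∈ range t, (D (ω (c x j)))⁻¹)
    (hA : ∀ x (f : β → ℝ), (∀ v, 0 ≤ f v) →
      ∑ v, f v ≤ ∑ ω ∈ M, f (ω x) * ∏ j ∈ range t, (D (ω (c x j)) - j)⁻¹)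
    (hB : ∀ x (f : β → ℝ), (∀ v, 0 ≤ f v) →
      ∑ ω ∈ M, f (ω x) * ∏ j ∈ range t, (D (ω (c x j)))⁻¹ ≤ ∑ v, f v) :
    n * ∏ j ∈ range t, (d - j) ≤ #M := by
  have ht1 : (1:ℝ) ≤ t := by exact_mod_cast (by omega)
  have hmt : (m:ℝ) + 1 = t := by rw [htm]; push_cast; ring
  have hd40 : 40 * (t:ℝ) ≤ d := by
    refine le_trans ?_ hd
    unfold dZero
    have : (0:ℝ) ≤ 18 * (2 ^ t * 8 * t ^ 2) * (t + 1) ^ 2 * t := by positivity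
    have : (0:ℝ) ≤ 12 * t * (2 ^ t * 12 * t) := by positivity
    linarith
  have hdp : 0 < d := by linarith
  have hD0 : ∀ v, 0 < D v := fun v => by have := hmin v; linarith
  set r : β → ℝ := fun v => Real.sqrt (d / D v) with hr
  have hr0 : ∀ v, 0 < r v := fun v => Real.sqrt_pos.2 (div_pos hdp (hD0 v))
  have hrsq : ∀ v, r v ^ 2 = d / D v := fun v => Real.sq_sqrt (div_pos hdp (hD0 v)).le
  have hDr : ∀ v, D v * r v ^ 2 = d := fun v => by
    rw [hrsq]; have := (hD0 v).ne'; field_simp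
  have hr2 : ∀ v, r v ≤ 2 := fun v => by
    have : r v ^ 2 ≤ 2 ^ 2 := by
      rw [hrsq, div_le_iff₀ (hD0 v)]; have := hmin v; linarith
    exact le_of_sq_le_sq this (by norm_num) 
  have hjd : ∀ j, j < t → 0 ≤ (j:ℝ) / d ∧ (j:ℝ) / d ≤ 1 / 8 ∧ (j:ℝ) / d ≤ t / d := by
    intro j hj
    have : (j:ℝ) ≤ t := by exact_mod_cast hj.le
    refine ⟨by positivity, ?_, by gcongr⟩
    rw [div_le_iff₀ hdp]; linarith
  have hjd' : ∀ j, j < t → 40 * (j:ℝ) ≤ d := by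
    intro j hj
    have : (j:ℝ) ≤ t := by exact_mod_cast hj.le
    linarith
  set ρ : α → (α → β) → ℝ := fun x ω => ∏ j ∈ range t, phi (j / d) (r (ω (c x j))) with hρd
  set π : β → ℝ := fun v => D v / (n * d) with hπd
  have hπ0 : ∀ v, 0 ≤ π v := fun v => by have := hD0 v; simp only [hπd]; positivity
  have hP : ∀ x ω, Q ω * ρ x ω = π (ω x) * ∏ j ∈ range t, (D (ω (c x j)) - j)⁻¹ := by
    intro x ω
    rw [hQ x, mul_assoc, ← prod_mul_distrib]
    congr 1
    apply prod_congr rfl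
    intro j hj
    unfold phi
    rw [← mul_inv, mul_sub]
    congr 2
    · ring
    · have := hDr (ω (c x j))
      calc D (ω (c x j)) * ((j : ℝ) / d * r (ω (c x j)) ^ 2) = (j : ℝ) / d * (D (ω (c x j)) * r (ω (c x j)) ^ 2) := by ring
        _ = (j : ℝ) := by rw [this]; field_simp
  have hQ0 : ∀ ω, 0 ≤ Q ω := by
    intro ω
    have : Nonempty α := Fintype.card_pos_iff.1 (by omega)
    obtain ⟨x⟩ := this
    rw [hQ x]
    exact mul_nonneg (hπ0 _) (prod_nonneg fun j _ => (inv_pos.2 (hD0 _)).le)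
  set b : ℕ → ℝ := fun j => ((j + 1 : ℕ) : ℝ) / (d - ((j + 1 : ℕ) : ℝ)) with hb
  set L : ℕ → β → ℝ := fun j v => ell (b j) (r v) with hLd
  set θ : β → ℝ := fun v => |1 - r v| with hθ
  set Ψ : ℝ := ∑ v, π v * θ v ^ 2 with hΨ
  have hπ1 : ∑ v, π v = 1 := by
    simp only [hπd]; rw [← sum_div, hsum]; field_simp
  have hπr : ∑ v, π v * (1 - r v ^ 2) = 0 := by
    simp only [mul_sub, mul_one, sum_sub_distrib]
    rw [hπ1]
    have : ∀ v, π v * r v ^ 2 = 1 / n := by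
      intro v
      simp only [hπd]
      rw [div_mul_eq_mul_div, hDr]; field_simp
    simp only [this, sum_const, card_univ, nsmul_eq_mul, hcard]
    field_simp; simp
  have hbb : ∀ j, j < m → 0 ≤ b j ∧ b j ≤ 1 / 20 := fun j hj =>
    beta_bd hdp (by positivity) (hjd' (j + 1) (by omega))
  have hE : ∀ j, j < m → Ψ / 2 ≤ ∑ v, π v * L j v := by
    intro j hj
    obtain ⟨b0, b1⟩ := hbb j hj
    have : ∑ v, (1 / 2 * (π v * θ v ^ 2) + (1 + b j) * (π v * (1 - r v ^ 2))) ≤ ∑ v, π v * L j v := by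
      apply sum_le_sum
      intro v _
      have := mul_le_mul_of_nonneg_left (ell_ge b0 b1 (hr0 v) (hr2 v)) (hπ0 v)
      simp only [hθ, hLd, sq_abs]
      linarith
    rw [sum_add_distrib, ← mul_sum, ← mul_sum, hπr] at this
    linarith
  have hρdiff : ∀ x ω, |ρ x ω - ∏ j ∈ range t, phi (j / d) 1| ≤
      2 ^ t * 12 * t / d * ∑ i ∈ range t, θ (ω (c x i)) := by
    intro x ω
    have h1 := prod_diff (range t) (fun j => phi (j / d) (r (ω (c x j)))) (fun j => phi (j / d) 1)
      (fun j hj => by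
        obtain ⟨u, v, _⟩ := hjd j (by simpa using hj)
        linarith [(phi_bd u v (hr0 (ω (c x j))) (hr2 _)).1])
      (fun j hj => by
        obtain ⟨u, v, _⟩ := hjd j (by simpa using hj)
        exact (phi_bd u v (hr0 (ω (c x j))) (hr2 _)).2)
      (fun j hj => by
        obtain ⟨u, v, _⟩ := hjd j (by simpa using hj)
        linarith [(phi_bd u v one_pos one_le_two).1])
      (fun j hj => by
        obtain ⟨u, v, _⟩ := hjd j (by simpa using hj)
        exact (phi_bd u v one_pos one_le_two).2)
    refine h1.trans ?_
    rw [card_range]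
    have : 2 ^ t * 12 * t / d * ∑ i ∈ range t, θ (ω (c x i))
      = 2 ^ t * ∑ i ∈ range t, 12 * (t / d) * θ (ω (c x i)) := by
      rw [← mul_sum]; ring
    rw [this]
    apply mul_le_mul_of_nonneg_left _ (by positivity)
    apply sum_le_sum
    intro j hj
    obtain ⟨u, v, w⟩ := hjd j (by simpa using hj)
    refine (phi_diff_one u v (hr0 (ω (c x j))) (hr2 _)).trans ?_
    have : 0 ≤ |1 - r (ω (c x j))| := abs_nonneg _
    simp only [hθ]
    gcongr
  have hρ1 : ∀ x ω, ρ x ω ≤ 1 + 2 ^ t * 8 * t ^ 2 / d := by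
    intro x ω
    have h1 := prod_diff (range t) (fun j => phi (j / d) (r (ω (c x j)))) (fun j => 1)
      (fun j hj => by
        obtain ⟨u, v, _⟩ := hjd j (by simpa using hj)
        linarith [(phi_bd u v (hr0 (ω (c x j))) (hr2 _)).1])
      (fun j hj => by
        obtain ⟨u, v, _⟩ := hjd j (by simpa using hj)
        exact (phi_bd u v (hr0 (ω (c x j))) (hr2 _)).2)
      (fun j hj => by norm_num) (fun j hj => by norm_num)
    have h2 : ∑ j ∈ range t, |phi (j / d) (r (ω (c x j))) - 1| ≤ t * (8 * (t / d)) := by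
      refine (sum_le_sum (g := fun _ => 8 * ((t:ℝ) / d)) ?_).trans (by simp)
      intro j hj
      obtain ⟨u, v, w⟩ := hjd j (by simpa using hj)
      refine (phi_sub_one u v (hr0 (ω (c x j))) (hr2 _)).trans ?_
      linarith
    rw [card_range, prod_const_one] at h1
    have h3 : 2 ^ t * 8 * (t:ℝ) ^ 2 / d = 2 ^ t * (t * (8 * (t / d))) := by ring
    have h4 := mul_le_mul_of_nonneg_left h2 (by positivity : (0:ℝ) ≤ 2 ^ t)
    have h5 := le_abs_self (ρ x ω - 1)
    have h6 : |ρ x ω - 1| ≤ _ := h1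
    rw [h3]
    linarith
  have hmain := assembly M Q hQ0 ρ π θ (fun v => abs_nonneg _) hπ0 L c m t Ψ
    (2 ^ t * 12 * t / d) (2 ^ t * 8 * t ^ 2 / d) hΨ (by positivity)
    (by
      intro x y ω
      have h1 := hρdiff x ω
      have h2 := hρdiff y ω
      have := abs_sub_le (ρ x ω) (∏ j ∈ range t, phi (j / d) 1) (ρ y ω)
      rw [abs_sub_comm (∏ j ∈ range t, phi (j / d) 1) (ρ y ω)] at this
      linarith)
    hρ1 (by positivity)
    (by
      intro x f hf
      refine (hA x (fun v => π v * f v) (fun v => mul_nonneg (hπ0 v) (hf v))).trans (le_of_eq ?_)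
      apply sum_congr rfl; intro ω _
      rw [hP]; ring)
    (by
      intro x f hf
      refine le_trans (le_of_eq ?_) (hB x (fun v => π v * f v) (fun v => mul_nonneg (hπ0 v) (hf v)))
      apply sum_congr rfl; intro ω _
      rw [hQ x]; ring)
    (by
      intro j v hj
      obtain ⟨b0, b1⟩ := hbb j hj
      exact abs_ell_le b0 b1 (hr0 v) (hr2 v))
    hE hπ1
  -- Jensen step
  set K : ℝ := n * ∏ j ∈ range t, (d - j) with hK
  have hdj : ∀ j, j < t → 0 < d - j := fun j hj => by
    have := hjd' j hj
    have : (0:ℝ) ≤ j := by positivity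
    linarith
  have hK0 : 0 < K := by
    rw [hK]; apply mul_pos hn (prod_pos _)
    intro j hj; exact hdj j (by simpa using hj)
  have hDj : ∀ j, j < t → ∀ v, 0 < D v - j := fun j hj v => by
    have := hjd' j hj
    have := hmin v
    have : (0:ℝ) ≤ j := by positivity
    linarith
  have hJ : ∀ x ω, K * (Q ω * ρ x ω * (1 + ∑ j ∈ range m, L j (ω (c x (j + 1))))) ≤ 1 := by
    intro x ω
    have e1 : K * (Q ω * ρ x ω) = ∏ j ∈ range m, ((d - ((j + 1 : ℕ) : ℝ)) *
        (D (ω (c x (j + 1))) - ((j + 1 : ℕ) : ℝ))⁻¹) := by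
      rw [hP, hK, htm, prod_range_succ', prod_range_succ', prod_mul_distrib, hc0]
      simp only [hπd]
      have := (hD0 (ω x)).ne'
      simp only [Nat.cast_zero, sub_zero]
      field_simp
    have hpos : 0 ≤ K * (Q ω * ρ x ω) := by
      rw [e1]; apply prod_nonneg
      intro j hj
      rw [mem_range] at hj
      exact mul_nonneg (hdj (j + 1) (by omega)).le (inv_pos.2 (hDj (j + 1) (by omega) _)).le
    have e2 : 1 + ∑ j ∈ range m, L j (ω (c x (j + 1))) ≤
        ∏ j ∈ range m, ((D (ω (c x (j + 1))) - ((j + 1 : ℕ) : ℝ)) / (d - ((j + 1 : ℕ) : ℝ))) := by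
      have h1 := Real.add_one_le_exp (∑ j ∈ range m, L j (ω (c x (j + 1))))
      rw [Real.exp_sum] at h1
      have h2 : ∏ j ∈ range m, Real.exp (L j (ω (c x (j + 1)))) ≤
        ∏ j ∈ range m, ((D (ω (c x (j + 1))) - ((j + 1 : ℕ) : ℝ)) / (d - ((j + 1 : ℕ) : ℝ))) := by
        apply prod_le_prod
        · intro j _; exact (Real.exp_pos _).le
        · intro j hj
          rw [mem_range] at hj
          exact exp_ell_le hdp (by positivity) (hjd' (j + 1) (by omega)) (hr0 _) (hr2 _) (hDr _)
      linarith
    rw [← mul_assoc]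
    refine (mul_le_mul_of_nonneg_left e2 hpos).trans (le_of_eq ?_)
    rw [e1, ← prod_mul_distrib]
    apply prod_eq_one
    intro j hj
    rw [mem_range] at hj
    have h1 := (hdj (j + 1) (by omega)).ne'
    have h2 := (hDj (j + 1) (by omega) (ω (c x (j + 1)))).ne'
    field_simp
  have hJs : K * ∑ x, ∑ ω ∈ M, Q ω * ρ x ω * (1 + ∑ j ∈ range m, L j (ω (c x (j + 1))))
      ≤ (Fintype.card α : ℝ) * #M := by
    rw [mul_sum]
    refine (sum_le_sum (g := fun _ => (#M : ℝ)) ?_).trans (by simp)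
    intro x _
    rw [mul_sum]
    refine (sum_le_sum fun ω _ => hJ x ω).trans (by simp)
  have hΨ0 : 0 ≤ Ψ := sum_nonneg fun v _ => mul_nonneg (hπ0 v) (sq_nonneg _)
  have hfin : 1 ≤ 1 + m / 2 * Ψ - 2 ^ t * 8 * t ^ 2 / d * (9 * (Fintype.card α) ^ 2 * m ^ 2) * Ψ
        - m * (6 * t * (2 ^ t * 12 * t / d)) * Ψ := by
    have hmle : (m:ℝ) ≤ t := by linarith
    have h1 : (2 ^ t * 8 * t ^ 2) * (9 * (t + 1) ^ 2 * m) + 6 * t * (2 ^ t * 12 * t) ≤ d / 2 := by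
      have : (2 ^ t * 8 * (t:ℝ) ^ 2) * (9 * (t + 1) ^ 2 * m) ≤ (2 ^ t * 8 * t ^ 2) * (9 * (t + 1) ^ 2 * t) := by
        gcongr
      have h3 := hd
      unfold dZero at h3
      linarith
    have h2 : ((2 ^ t * 8 * t ^ 2) * (9 * (t + 1) ^ 2 * m) + 6 * t * (2 ^ t * 12 * t)) / d ≤ 1 / 2 := by
      rw [div_le_iff₀ hdp]; linarith
    have h3 := mul_le_mul_of_nonneg_left h2 (by positivity : 0 ≤ (m:ℝ) * Ψ)
    rw [hα]; push_cast
    have e : (m:ℝ) * Ψ * (((2 ^ t * 8 * t ^ 2) * (9 * (t + 1) ^ 2 * m) + 6 * t * (2 ^ t * 12 * t)) / d)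
      = 2 ^ t * 8 * t ^ 2 / d * (9 * (t + 1) ^ 2 * m ^ 2) * Ψ + m * (6 * t * (2 ^ t * 12 * t / d)) * Ψ := by
      field_simp
    rw [e] at h3
    linarith
  have hN : (0:ℝ) < Fintype.card α := by rw [hα]; positivity
  have h1 := mul_le_mul_of_nonneg_left hfin hN.le
  have h2 := mul_le_mul_of_nonneg_left (h1.trans hmain) hK0.le
  have h3 := h2.trans hJs
  have h4 : (Fintype.card α : ℝ) * K ≤ (Fintype.card α : ℝ) * #M := by linarith
  exact le_of_mul_le_mul_left h4 hN

end TreeCount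

/-- Lemma 1.3 (lower bound): the tree-counting lower bound under the additional
assumption that the minimum degree satisfies `δ(G) ≥ d/4`. -/
theorem tree_count_lower_bound_min_degree (t : ℕ) (ht : 0 < t) :
    ∃ d0 : ℝ, ∀ (α β : Type) [Fintype α] [Fintype β]
      (T : SimpleGraph α) (G : SimpleGraph β),
      T.IsTree → Fintype.card α = t + 1 →
      d0 ≤ avgDeg G →
      (∀ v : β, avgDeg G / 4 ≤ (Nat.card (G.neighborSet v) : ℝ)) →
      (Fintype.card β : ℝ) * fallFact (avgDeg G) t ≤ (monCount T G : ℝ) := by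
  classical
  refine ⟨TreeCount.dZero t, ?_⟩
  intro α β _ _ T G hT hα hd hmin
  set d := avgDeg G with hdd
  have ht1 : (1:ℝ) ≤ t := by exact_mod_cast ht
  have hd40 : 40 * (t:ℝ) ≤ d := by
    refine le_trans ?_ hd
    unfold TreeCount.dZero
    have : (0:ℝ) ≤ 18 * (2 ^ t * 8 * t ^ 2) * (t + 1) ^ 2 * t := by positivity
    have : (0:ℝ) ≤ 12 * t * (2 ^ t * 12 * t) := by positivity
    linarith
  have hn : 0 < Fintype.card β := by
    rcases Nat.eq_zero_or_pos (Fintype.card β) with h | h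
    · have : d = 0 := by rw [hdd]; unfold avgDeg; rw [h]; simp
      linarith
    · exact h
  have hn' : (0:ℝ) < Fintype.card β := by exact_mod_cast hn
  have hdeg : ∀ v, Nat.card (G.neighborSet v) = G.degree v := fun v => by
    rw [Nat.card_eq_fintype_card, SimpleGraph.card_neighborSet_eq_degree]
  have hmin' : ∀ v, d / 4 ≤ (G.degree v : ℝ) := fun v => by rw [← hdeg]; exact hmin v
  have htdeg : ∀ v, t < G.degree v := fun v => by
    have := hmin' v
    have : (t:ℝ) < G.degree v := by linarith
    exact_mod_cast this
  have hsum : ∑ v, (G.degree v : ℝ) = (Fintype.card β : ℝ) * d := by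
    have h1 := G.sum_degrees_eq_twice_card_edges
    have h2 : ∑ v, (G.degree v : ℝ) = 2 * (#G.edgeFinset : ℝ) := by exact_mod_cast h1
    rw [h2, hdd]; unfold avgDeg
    rw [Nat.card_eq_fintype_card, SimpleGraph.edgeFinset_card]
    field_simp
  choose e p h using fun x : α => TreeCount.exists_order_aux T hT.connected x t (by omega)
  set M : Finset (α → β) := univ.filter (fun ω : α → β => Function.Injective ω ∧
      ∀ ⦃u v : α⦄, T.Adj u v → G.Adj (ω u) (ω v)) with hM
  have hmon : monCount T G = #M := by
    unfold monCount
    rw [Nat.card_eq_fintype_card, Fintype.card_subtype]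
  rw [hmon]
  unfold fallFact
  refine TreeCount.core (t - 1) t (by omega) hα M (fun v => (G.degree v : ℝ)) d _ hn' hd hmin' hsum rfl
    (fun x j => e x (p x j)) ?_ (fun ω => (∏ a, (G.degree (ω a) : ℝ)) *
      (∏ z ∈ T.edgeFinset, Sym2.lift ⟨fun a b => (G.degree (ω a) : ℝ) * (G.degree (ω b) : ℝ),
        fun a b => mul_comm _ _⟩ z)⁻¹ / (Fintype.card β * d)) ?_ ?_ ?_
  · intro x
    have := (h x).ple 0 ht
    have h0 : p x 0 = 0 := by omega
    simp only [h0]; exact (h x).root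
  · intro x ω
    rw [← (h x).prod_parent hT hα (fun a => (G.degree (ω a) : ℝ)) (fun a => by
      have := htdeg (ω a)
      exact_mod_cast (by omega : G.degree (ω a) ≠ 0))]
    ring
  · intro x f hf
    exact (h x).lower hT hα G hn htdeg f hf
  · intro x f hf
    exact (h x).upper hα G hn htdeg f hf
end

section
/- For every positive integer t there exists a constant d0(t) with the following property: for every tree T on t+1 vertices of diameter at least 3 and every finite simple graph G on n vertices with average degree d ≥ d0(t) and minimum degree δ(G) ≥ d/4, the number of injective homomorphisms from T to G equals n·d(d−1)···(d−t+1) if and only if every connected component of G is a complete graph on d+1 vertices. -/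
/-- `G` is a vertex-disjoint union of complete graphs, each on `m` vertices:
every connected component has `m` vertices and is a clique. -/
def componentsAreCliques {β : Type} (G : SimpleGraph β) (m : ℕ) : Prop :=
  ∀ c : G.ConnectedComponent, c.supp.ncard = m ∧ c.supp.Pairwise G.Adj

namespace TC
open Finset
open scoped Classical
noncomputable section

variable {β : Type} [Fintype β]

/-- available vertices for the step `j+1` -/
def Av (G : SimpleGraph β) (P : ℕ → ℕ) (j : ℕ) (x : ℕ → β) : Finset β :=
  G.neighborFinset (x (P j)) \ (range (j+1)).image x

/-- embedded sequences of the first `i+1` vertices -/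
def X (G : SimpleGraph β) (P : ℕ → ℕ) : ℕ → Finset (ℕ → β)
  | 0 => univ.image (fun v => fun _ => v)
  | i+1 => (X G P i).biUnion fun x => (Av G P i x).image (fun y => Function.update x (i+1) y)

def wt (G : SimpleGraph β) (P : ℕ → ℕ) (d : ℝ) (i : ℕ) (x : ℕ → β) : ℝ :=
  (G.degree (x 0) : ℝ) / (Fintype.card β * d) * ∏ j ∈ range i, ((Av G P j x).card : ℝ)⁻¹

def E (G : SimpleGraph β) (P : ℕ → ℕ) (d : ℝ) (i : ℕ) (F : (ℕ → β) → ℝ) : ℝ :=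
  ∑ x ∈ X G P i, wt G P d i x * F x

def M (G : SimpleGraph β) (d : ℝ) (ψ : β → ℝ) : ℝ :=
  ∑ v, (G.degree v : ℝ) / (Fintype.card β * d) * ψ v

def av (G : SimpleGraph β) (ψ : β → ℝ) (v : β) : ℝ :=
  (∑ y ∈ G.neighborFinset v, ψ y) / G.degree v

def rho (G : SimpleGraph β) (d : ℝ) (v : β) : ℝ := 1 - d / G.degree v

def eta (G : SimpleGraph β) (P : ℕ → ℕ) (j : ℕ) (x : ℕ → β) : ℝ :=
  if (Av G P j x).card + j = G.degree (x (P j)) then 0 else 1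

structure Hyp (G : SimpleGraph β) (P : ℕ → ℕ) (t : ℕ) (d : ℝ) : Prop where
  hP : ∀ j, P j ≤ j
  hsum : ∑ v, (G.degree v : ℝ) = Fintype.card β * d
  hmin : ∀ v, d / 4 ≤ G.degree v
  hd : 16 * ((t : ℝ) + 1) ≤ d
  hn : 0 < Fintype.card β

theorem mem_X {G : SimpleGraph β} {P : ℕ → ℕ} (hP : ∀ j, P j ≤ j) (i : ℕ) (x : ℕ → β) :
    x ∈ X G P i ↔ Set.InjOn x (Set.Iic i) ∧ (∀ j < i, G.Adj (x (P j)) (x (j+1))) ∧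
      ∀ j, i < j → x j = x 0 := by
  induction i generalizing x with
  | zero =>
    simp only [X, mem_image, mem_univ, true_and]
    constructor
    · rintro ⟨v, rfl⟩
      refine ⟨?_, by simp, by simp⟩
      intro a ha b hb _
      simp at ha hb; omega
    · rintro ⟨_, _, h⟩
      refine ⟨x 0, ?_⟩
      funext j
      rcases Nat.eq_zero_or_pos j with rfl | hj
      · rfl
      · exact (h j hj).symm
  | succ i ih =>
    simp only [X, mem_biUnion, mem_image]
    constructor
    · rintro ⟨x', hx', y, hy, rfl⟩
      obtain ⟨h1, h2, h3⟩ := (ih x').1 hx'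
      simp only [Av, mem_sdiff, SimpleGraph.mem_neighborFinset, mem_image, mem_range, not_exists,
        not_and] at hy
      obtain ⟨hy1, hy2⟩ := hy
      refine ⟨?_, ?_, ?_⟩
      · intro a ha b hb hab
        simp only [Set.mem_Iic] at ha hb
        by_cases ha' : a = i+1 <;> by_cases hb' : b = i+1
        · omega
        · subst ha'
          simp only [Function.update_self, Function.update_of_ne hb'] at hab
          exact absurd hab.symm (hy2 b (by omega))
        · subst hb'
          simp only [Function.update_self, Function.update_of_ne ha'] at hab
          exact absurd hab (hy2 a (by omega))
        · simp only [Function.update_of_ne ha', Function.update_of_ne hb'] at hab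
          exact h1 (by simp; omega) (by simp; omega) hab
      · intro j hj
        have := hP j
        rw [Function.update_of_ne (by omega)]
        by_cases hji : j = i
        · subst hji; simpa using hy1
        · rw [Function.update_of_ne (by omega)]
          exact h2 j (by omega)
      · intro j hj
        rw [Function.update_of_ne (by omega), Function.update_of_ne (by omega)]
        exact h3 j (by omega)
    · rintro ⟨h1, h2, h3⟩
      refine ⟨Function.update x (i+1) (x 0), ?_, x (i+1), ?_, ?_⟩
      · rw [ih]
        refine ⟨?_, ?_, ?_⟩
        · intro a ha b hb hab
          simp only [Set.mem_Iic] at ha hb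
          rw [Function.update_of_ne (by omega), Function.update_of_ne (by omega)] at hab
          exact h1 (by simp; omega) (by simp; omega) hab
        · intro j hj
          have := hP j
          rw [Function.update_of_ne (by omega), Function.update_of_ne (by omega)]
          exact h2 j (by omega)
        · intro j hj
          rw [Function.update_of_ne (a := 0) (by omega)]
          by_cases hji : j = i+1
          · subst hji; simp
          · rw [Function.update_of_ne (by omega)]
            exact h3 j (by omega)
      · simp only [Av, mem_sdiff, SimpleGraph.mem_neighborFinset, mem_image, mem_range, not_exists,
          not_and]
        have := hP i
        rw [Function.update_of_ne (by omega)]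
        refine ⟨h2 i (by omega), ?_⟩
        intro k hk
        rw [Function.update_of_ne (by omega)]
        intro h
        have := h1 (by simp; omega) (by simp) h
        omega
      · simp

theorem sum_X {G : SimpleGraph β} {P : ℕ → ℕ} (hP : ∀ j, P j ≤ j) (i : ℕ) (F : (ℕ → β) → ℝ) :
    ∑ x ∈ X G P (i+1), F x =
      ∑ x ∈ X G P i, ∑ y ∈ Av G P i x, F (Function.update x (i+1) y) := by
  have key : ∀ x ∈ X G P i, ∀ x' ∈ X G P i, ∀ y y', Function.update x (i+1) y =
      Function.update x' (i+1) y' → x = x' := by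
    intro x hx x' hx' y y' h
    have e1 := ((mem_X hP i x).1 hx).2.2 (i+1) (by omega)
    have e2 := ((mem_X hP i x').1 hx').2.2 (i+1) (by omega)
    have h0 : ∀ j, j ≠ i+1 → x j = x' j := by
      intro j hj
      have := congrFun h j
      rwa [Function.update_of_ne hj, Function.update_of_ne hj] at this
    funext j
    by_cases hj : j = i+1
    · subst hj; rw [e1, e2]; exact h0 0 (by omega)
    · exact h0 j hj
  rw [X, sum_biUnion]
  · refine sum_congr rfl fun x hx => ?_
    rw [sum_image]
    intro a _ b _ hab
    have := congrFun hab (i+1)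
    simpa using this
  · intro x hx x' hx' hne
    rw [Function.onFun, disjoint_left]
    intro z hz hz'
    simp only [mem_image] at hz hz'
    obtain ⟨y, _, rfl⟩ := hz
    obtain ⟨y', _, h⟩ := hz'
    exact hne (key x hx x' hx' y y' h.symm)

/-- dependence on the coordinates up to `i` only -/
def Dep {γ : Type} (i : ℕ) (F : (ℕ → β) → γ) : Prop :=
  ∀ x x' : ℕ → β, (∀ k ≤ i, x k = x' k) → F x = F x'

theorem Dep_Av (G : SimpleGraph β) {P : ℕ → ℕ} (hP : ∀ j, P j ≤ j) (j : ℕ) :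
    Dep j (Av G P j) := by
  intro x x' h
  have : (range (j+1)).image x = (range (j+1)).image x' := by
    apply image_congr
    intro k hk
    simp at hk
    exact h k (by omega)
  rw [Av, Av, this, h _ (hP j)]

theorem Dep.mono {γ : Type} {i i' : ℕ} {F : (ℕ → β) → γ} (h : Dep i F) (hi : i ≤ i') : Dep i' F :=
  fun x x' hx => h x x' fun k hk => hx k (hk.trans hi)

theorem upd {γ : Type} {i : ℕ} {F : (ℕ → β) → γ} (h : Dep i F) (x : ℕ → β) (y : β) :
    F (Function.update x (i+1) y) = F x :=
  h _ _ fun k hk => Function.update_of_ne (by omega) _ _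

theorem wt_upd (G : SimpleGraph β) {P : ℕ → ℕ} (hP : ∀ j, P j ≤ j) (d : ℝ) (i : ℕ)
    (x : ℕ → β) (y : β) : wt G P d (i+1) (Function.update x (i+1) y) =
      wt G P d i x * ((Av G P i x).card : ℝ)⁻¹ := by
  rw [wt, wt, prod_range_succ, upd (Dep_Av G hP i), Function.update_of_ne (by omega), mul_assoc]
  congr 2
  refine prod_congr rfl fun j hj => ?_
  simp at hj
  rw [upd ((Dep_Av G hP j).mono hj.le)]

theorem E_succ (G : SimpleGraph β) {P : ℕ → ℕ} (hP : ∀ j, P j ≤ j) (d : ℝ) (i : ℕ)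
    (F : (ℕ → β) → ℝ) : E G P d (i+1) F = E G P d i (fun x =>
      (∑ y ∈ Av G P i x, F (Function.update x (i+1) y)) / (Av G P i x).card) := by
  rw [E, E, sum_X hP]
  refine sum_congr rfl fun x hx => ?_
  simp_rw [wt_upd G hP]
  rw [← mul_sum]
  ring

section hyp
variable {G : SimpleGraph β} {P : ℕ → ℕ} {t : ℕ} {d : ℝ}

theorem Hyp.dpos (H : Hyp G P t d) : 0 < d := by
  have := H.hd
  have : (0:ℝ) ≤ t := by positivity
  linarith

theorem Hyp.degpos (H : Hyp G P t d) (v : β) : (0:ℝ) < G.degree v := by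
  have := H.hmin v
  have := H.dpos
  linarith

theorem Hyp.degt (H : Hyp G P t d) (v : β) : 4 * ((t:ℝ) + 1) ≤ G.degree v := by
  have := H.hmin v
  have := H.hd
  linarith

theorem Hyp.npos (H : Hyp G P t d) : (0:ℝ) < Fintype.card β := by exact_mod_cast H.hn

theorem Hyp.card_ge (H : Hyp G P t d) (j : ℕ) (x : ℕ → β) : G.degree (x (P j)) ≤ (Av G P j x).card + j := by
  have hs : G.neighborFinset (x (P j)) ⊆ Av G P j x ∪ ((range (j+1)).erase (P j)).image x := by
    intro y hy
    by_cases h : y ∈ Av G P j x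
    · exact mem_union_left _ h
    · apply mem_union_right
      simp only [Av, mem_sdiff, hy, true_and, not_not] at h
      obtain ⟨k, hk, rfl⟩ := mem_image.1 h
      refine mem_image.2 ⟨k, mem_erase.2 ⟨?_, hk⟩, rfl⟩
      rintro rfl
      simp at hy
  have h1 := card_le_card hs
  have h2 := card_union_le (Av G P j x) (((range (j+1)).erase (P j)).image x)
  have h3 : (((range (j+1)).erase (P j)).image x).card ≤ j := by
    refine card_image_le.trans ?_
    rw [card_erase_of_mem (by have := H.hP j; simp; omega)]
    simp
  rw [SimpleGraph.card_neighborFinset_eq_degree] at h1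
  omega

theorem Hyp.card_half (H : Hyp G P t d) (j : ℕ) (hj : j ≤ t) (x : ℕ → β) :
    (G.degree (x (P j)) : ℝ) / 2 ≤ (Av G P j x).card := by
  have h1 : (G.degree (x (P j)) : ℝ) ≤ (Av G P j x).card + j := by exact_mod_cast H.card_ge j x
  have h2 := H.degt (x (P j))
  have h3 : (j:ℝ) ≤ t := by exact_mod_cast hj
  linarith

theorem Hyp.card_pos (H : Hyp G P t d) (j : ℕ) (hj : j ≤ t) (x : ℕ → β) : (0:ℝ) < (Av G P j x).card := by
  have := H.card_half j hj x
  have := H.degpos (x (P j))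
  linarith

theorem Hyp.wt_pos (H : Hyp G P t d) (i : ℕ) (hi : i ≤ t) (x : ℕ → β) : 0 < wt G P d i x := by
  have := H.degpos (x 0)
  have := H.npos
  have := H.dpos
  rw [wt]
  apply mul_pos
  · positivity
  · apply prod_pos
    intro j hj
    simp at hj
    have := H.card_pos j (by omega) x
    positivity

theorem Hyp.E_stable (H : Hyp G P t d) {i : ℕ} {F : (ℕ → β) → ℝ} (hF : Dep i F) (i' : ℕ) (hii : i ≤ i')
    (hi' : i' ≤ t) : E G P d i' F = E G P d i F := by
  induction i', hii using Nat.le_induction with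
  | base => rfl
  | succ m hm ih =>
    rw [← ih (by omega), E_succ G H.hP]
    congr 1
    funext x
    simp_rw [upd (hF.mono hm)]
    have := H.card_pos m (by omega) x
    rw [sum_const, nsmul_eq_mul]
    field_simp

theorem Hyp.E_zero (H : Hyp G P t d) (ψ : β → ℝ) : E G P d 0 (fun x => ψ (x 0)) = M G d ψ := by
  rw [E, M, X, sum_image]
  · simp [wt]
  · intro a _ b _ h
    exact congrFun h 0

theorem Hyp.E_x0 (H : Hyp G P t d) (ψ : β → ℝ) : E G P d t (fun x => ψ (x 0)) = M G d ψ := by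
  rw [← H.E_zero]
  refine H.E_stable ?_ t (by omega) le_rfl
  intro x x' h
  simp only [h 0 le_rfl]

theorem Hyp.E_step (H : Hyp G P t d) (j : ℕ) (hj : j < t) (ψ : β → ℝ) : E G P d t (fun x => ψ (x (j+1))) =
    E G P d t (fun x => (∑ y ∈ Av G P j x, ψ y) / (Av G P j x).card) := by
  rw [H.E_stable (i := j+1) ?_ t (by omega) le_rfl, H.E_stable (i := j) ?_ t (by omega) le_rfl,
    E_succ G H.hP]
  · simp
  · intro x x' h
    simp only [Dep_Av G H.hP j x x' h]
  · intro x x' h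
    simp only [h (j+1) le_rfl]

theorem Hyp.M_one (H : Hyp G P t d) : M G d (fun _ => 1) = 1 := by
  have := H.npos
  have := H.dpos
  simp only [M, mul_one]
  rw [← sum_div, H.hsum]
  field_simp

theorem Hyp.E_one (H : Hyp G P t d) : E G P d t (fun _ => 1) = 1 := by
  rw [H.E_x0 (fun _ => 1), H.M_one]

theorem Hyp.M_av (H : Hyp G P t d) (ψ : β → ℝ) : M G d (av G ψ) = M G d ψ := by
  have h1 : ∀ v, (G.degree v : ℝ) / (Fintype.card β * d) * av G ψ v =
      ∑ y, (if G.Adj v y then ψ y / (Fintype.card β * d) else 0) := by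
    intro v
    have := H.degpos v
    have := H.npos
    have := H.dpos
    rw [← sum_filter, ← sum_div, av]
    have : univ.filter (fun y => G.Adj v y) = G.neighborFinset v := by
      ext y; simp
    rw [this]
    field_simp
  rw [M, M, sum_congr rfl fun v _ => h1 v, sum_comm]
  refine sum_congr rfl fun y _ => ?_
  rw [← sum_filter, sum_const, nsmul_eq_mul]
  have : univ.filter (fun v => G.Adj v y) = G.neighborFinset y := by
    ext v; simp [SimpleGraph.adj_comm]
  rw [this, SimpleGraph.card_neighborFinset_eq_degree]
  ring

theorem Hyp.M_rho (H : Hyp G P t d) : M G d (rho G d) = 0 := by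
  have h1 : ∀ v, (G.degree v : ℝ) / (Fintype.card β * d) * rho G d v =
      (G.degree v - d) / (Fintype.card β * d) := by
    intro v
    have := H.degpos v
    have := H.npos
    have := H.dpos
    rw [rho]
    field_simp
  rw [M, sum_congr rfl fun v _ => h1 v, ← sum_div, sum_sub_distrib, H.hsum]
  simp

theorem Hyp.E_mono (H : Hyp G P t d) {F F' : (ℕ → β) → ℝ} (h : ∀ x, F x ≤ F' x) : E G P d t F ≤ E G P d t F' :=
  sum_le_sum fun x _ => mul_le_mul_of_nonneg_left (h x) (H.wt_pos t le_rfl x).le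

end hyp

theorem E_add (G : SimpleGraph β) (P : ℕ → ℕ) (d : ℝ) (i : ℕ) (F F' : (ℕ → β) → ℝ) :
    E G P d i (fun x => F x + F' x) = E G P d i F + E G P d i F' := by
  simp [E, mul_add, sum_add_distrib]

theorem E_sub (G : SimpleGraph β) (P : ℕ → ℕ) (d : ℝ) (i : ℕ) (F F' : (ℕ → β) → ℝ) :
    E G P d i (fun x => F x - F' x) = E G P d i F - E G P d i F' := by
  simp [E, mul_sub, sum_sub_distrib]

theorem E_mul (G : SimpleGraph β) (P : ℕ → ℕ) (d : ℝ) (i : ℕ) (c : ℝ) (F : (ℕ → β) → ℝ) :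
    E G P d i (fun x => c * F x) = c * E G P d i F := by
  simp only [E, mul_sum]
  exact sum_congr rfl fun x _ => by ring

theorem E_sum {ι : Type} (s : Finset ι) (G : SimpleGraph β) (P : ℕ → ℕ) (d : ℝ) (i : ℕ)
    (F : ι → (ℕ → β) → ℝ) :
    E G P d i (fun x => ∑ k ∈ s, F k x) = ∑ k ∈ s, E G P d i (F k) := by
  simp only [E, mul_sum]
  exact sum_comm

end
end TC

namespace TC
open Finset
open scoped Classical
noncomputable section

variable {β : Type} [Fintype β]

theorem sum_im_le {g : β → ℝ} (hg : ∀ y, 0 ≤ g y) (s : Finset ℕ) (x : ℕ → β) :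
    ∑ y ∈ s.image x, g y ≤ ∑ k ∈ s, g (x k) := by
  induction s using Finset.induction_on with
  | empty => simp
  | insert a s ha ih =>
    rw [sum_insert ha, image_insert]
    by_cases h : x a ∈ s.image x
    · rw [insert_eq_of_mem h]
      have := hg (x a)
      linarith
    · rw [sum_insert h]
      linarith

section hyp
variable {G : SimpleGraph β} {P : ℕ → ℕ} {t : ℕ} {d : ℝ}

theorem Hyp.sq_av (H : Hyp G P t d) (ψ : β → ℝ) (v : β) : (av G ψ v)^2 ≤ av G (fun y => (ψ y)^2) v := by
  have h := sq_sum_le_card_mul_sum_sq (s := G.neighborFinset v) (f := ψ)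
  rw [SimpleGraph.card_neighborFinset_eq_degree] at h
  have h0 := H.degpos v
  rw [av, av, div_pow, div_le_div_iff₀ (by positivity) h0]
  nlinarith

theorem Hyp.av_nonneg (H : Hyp G P t d) {ψ : β → ℝ} (h : ∀ v, 0 ≤ ψ v) (v : β) : 0 ≤ av G ψ v :=
  div_nonneg (sum_nonneg fun y _ => h y) (H.degpos v).le

theorem Hyp.E_le (H : Hyp G P t d) (i : ℕ) (hi : i ≤ t) (ψ : β → ℝ) (h : ∀ v, 0 ≤ ψ v) :
    E G P d t (fun x => ψ (x i)) ≤ 2^i * M G d ψ := by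
  induction i using Nat.strong_induction_on generalizing ψ with
  | _ i ih =>
  have hM : ∀ ψ : β → ℝ, (∀ v, 0 ≤ ψ v) → 0 ≤ M G d ψ := by
    intro ψ h
    refine sum_nonneg fun v _ => mul_nonneg ?_ (h v)
    have := H.npos
    have := H.dpos
    positivity
  rcases i with _ | j
  · rw [H.E_x0]; simp
  · rw [H.E_step j (by omega)]
    have h1 : ∀ x : ℕ → β, (∑ y ∈ Av G P j x, ψ y) / (Av G P j x).card ≤
        2 * av G ψ (x (P j)) := by
      intro x
      have a1 := H.card_half j (by omega) x
      have a2 := H.card_pos j (by omega) x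
      have a3 := H.degpos (x (P j))
      have a4 : ∑ y ∈ Av G P j x, ψ y ≤ ∑ y ∈ G.neighborFinset (x (P j)), ψ y :=
        sum_le_sum_of_subset_of_nonneg sdiff_subset fun y _ _ => h y
      have a5 : 0 ≤ ∑ y ∈ G.neighborFinset (x (P j)), ψ y := sum_nonneg fun y _ => h y
      rw [av, ← mul_div_assoc, div_le_div_iff₀ a2 a3]
      nlinarith
    have hPj := H.hP j
    calc _ ≤ E G P d t (fun x => 2 * av G ψ (x (P j))) := H.E_mono h1
      _ = 2 * E G P d t (fun x => av G ψ (x (P j))) := E_mul ..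
      _ ≤ 2 * (2^(P j) * M G d (av G ψ)) := by
        have := ih (P j) (by omega) (by omega) (av G ψ) (H.av_nonneg h)
        linarith
      _ = 2^(P j + 1) * M G d ψ := by rw [H.M_av]; ring
      _ ≤ 2^(j+1) * M G d ψ := by
        apply mul_le_mul_of_nonneg_right _ (hM ψ h)
        exact pow_le_pow_right₀ (by norm_num) (by omega)

theorem Hyp.E_sq (H : Hyp G P t d) (i : ℕ) (hi : i ≤ t) (ψ : β → ℝ) {S : ℝ} (h : M G d (fun v => (ψ v)^2) ≤ S) :
    E G P d t (fun x => (ψ (x i))^2) ≤ 2^t * S := by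
  have h0 : 0 ≤ M G d (fun v => (ψ v)^2) := by
    refine sum_nonneg fun v _ => mul_nonneg ?_ (sq_nonneg _)
    have := H.npos
    have := H.dpos
    positivity
  refine (H.E_le i hi (fun v => (ψ v)^2) fun v => sq_nonneg _).trans ?_
  have : (2:ℝ)^i ≤ 2^t := pow_le_pow_right₀ (by norm_num) hi
  nlinarith [pow_pos (two_pos : (0:ℝ)<2) i]

theorem Hyp.M_sq_av (H : Hyp G P t d) (ψ : β → ℝ) {S : ℝ} (h : M G d (fun v => (ψ v)^2) ≤ S) :
    M G d (fun v => (av G ψ v)^2) ≤ S := by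
  refine le_trans ?_ h
  rw [← H.M_av (fun v => (ψ v)^2)]
  refine sum_le_sum fun v _ => mul_le_mul_of_nonneg_left (H.sq_av ψ v) ?_
  have := H.npos
  have := H.dpos
  positivity

theorem Hyp.eta_zero (H : Hyp G P t d) (j : ℕ) (x : ℕ → β) (he : (Av G P j x).card + j = G.degree (x (P j)))
    : G.neighborFinset (x (P j)) ∩ (range (j+1)).image x = ((range (j+1)).erase (P j)).image x ∧
      Set.InjOn x ((range (j+1)).erase (P j)) := by
  have hc := card_sdiff_add_card_inter (G.neighborFinset (x (P j))) ((range (j+1)).image x)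
  rw [SimpleGraph.card_neighborFinset_eq_degree] at hc
  have hc' : (G.neighborFinset (x (P j)) ∩ (range (j+1)).image x).card = j := by
    rw [Av] at he; omega
  have hs : G.neighborFinset (x (P j)) ∩ (range (j+1)).image x ⊆
      ((range (j+1)).erase (P j)).image x := by
    intro y hy
    obtain ⟨h1, h2⟩ := mem_inter.1 hy
    obtain ⟨k, hk, rfl⟩ := mem_image.1 h2
    refine mem_image.2 ⟨k, mem_erase.2 ⟨?_, hk⟩, rfl⟩
    rintro rfl
    simp at h1
  have hj : ((range (j+1)).erase (P j)).card = j := by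
    rw [card_erase_of_mem (by have := H.hP j; simp; omega)]
    simp
  have h3 : (((range (j+1)).erase (P j)).image x).card ≤ j := card_image_le.trans hj.le
  have heq := eq_of_subset_of_card_le hs (by omega)
  refine ⟨heq, ?_⟩
  apply card_image_iff.1
  rw [← heq, hc', hj]

theorem Hyp.pointwise (H : Hyp G P t d) (j : ℕ) (hj : j ≤ t) (x : ℕ → β) (ψ : β → ℝ) :
    |(∑ y ∈ Av G P j x, ψ y) / (Av G P j x).card - av G ψ (x (P j))
      - (1/(d-j)) * ∑ k ∈ (range (j+1)).erase (P j), (av G ψ (x (P j)) - ψ (x k))| ≤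
    10 / d * ((∑ k ∈ range (j+1), (|av G ψ (x (P j))| + |ψ (x k)|)) *
      (|rho G d (x (P j))| + eta G P j x)) := by
  set a := av G ψ (x (P j)) with ha
  set W := ∑ k ∈ range (j+1), (|a| + |ψ (x k)|) with hW
  set T := ∑ k ∈ (range (j+1)).erase (P j), (a - ψ (x k)) with hT
  set B := G.neighborFinset (x (P j)) ∩ (range (j+1)).image x with hB
  have hd := H.dpos
  have hd' := H.hd
  have hjt : (j:ℝ) ≤ t := by exact_mod_cast hj
  have hj0 : (0:ℝ) ≤ j := by positivity
  have hdeg := H.degpos (x (P j))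
  have hdeg' := H.degt (x (P j))
  have hmin := H.hmin (x (P j))
  have hA := H.card_pos j hj x
  have hA2 := H.card_half j hj x
  have hW0 : 0 ≤ W := sum_nonneg fun k _ => by positivity
  have hTW : |T| ≤ W := by
    refine (abs_sum_le_sum_abs _ _).trans ?_
    refine (sum_le_sum_of_subset_of_nonneg (erase_subset _ _) fun _ _ _ => abs_nonneg _).trans ?_
    exact sum_le_sum fun k _ => abs_sub _ _
  have hcardB : ((Av G P j x).card : ℝ) + B.card = G.degree (x (P j)) := by
    have hc := card_sdiff_add_card_inter (G.neighborFinset (x (P j))) ((range (j+1)).image x)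
    rw [SimpleGraph.card_neighborFinset_eq_degree] at hc
    exact_mod_cast hc
  have hsum : (∑ y ∈ Av G P j x, ψ y) + ∑ y ∈ B, ψ y = a * G.degree (x (P j)) := by
    rw [ha, av, div_mul_cancel₀ _ hdeg.ne', Av, hB]
    rw [← sum_inter_add_sum_sdiff (G.neighborFinset (x (P j))) ((range (j+1)).image x)]
    ring
  have hmain : (∑ y ∈ Av G P j x, ψ y) / (Av G P j x).card - a =
      (∑ y ∈ B, (a - ψ y)) / (Av G P j x).card := by
    rw [sum_sub_distrib, sum_const, nsmul_eq_mul]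
    field_simp
    rw [← hcardB] at hsum
    linarith
  rw [hmain]
  by_cases he : (Av G P j x).card + j = G.degree (x (P j))
  · obtain ⟨h1, h2⟩ := H.eta_zero j x he
    have hBT : ∑ y ∈ B, (a - ψ y) = T := by
      rw [hB, h1, sum_image h2]
    have heta : eta G P j x = 0 := by rw [eta, if_pos he]
    have hAc : ((Av G P j x).card : ℝ) = G.degree (x (P j)) - j := by
      rw [← he]; push_cast; ring
    rw [hBT, heta, add_zero, hAc]
    rw [hAc] at hA hA2
    have hdj : 0 < d - j := by linarith
    have e1 : T / ((G.degree (x (P j)) : ℝ) - j) - 1 / (d - j) * T =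
        T * (-(rho G d (x (P j)))) * ((G.degree (x (P j)) : ℝ) /
          (((G.degree (x (P j)) : ℝ) - j) * (d - j))) := by
      rw [rho]
      field_simp
      ring
    have e2 : (G.degree (x (P j)) : ℝ) / (((G.degree (x (P j)) : ℝ) - j) * (d - j)) ≤ 10 / d := by
      rw [div_le_div_iff₀ (by positivity) hd]
      have : d / 2 ≤ d - j := by linarith
      nlinarith [mul_le_mul hA2 this (by positivity) (by positivity)]
    have e3 : 0 ≤ (G.degree (x (P j)) : ℝ) / (((G.degree (x (P j)) : ℝ) - j) * (d - j)) := by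
      positivity
    rw [e1, abs_mul, abs_mul, abs_neg, abs_of_nonneg e3, mul_comm]
    gcongr
  · have heta : eta G P j x = 1 := by rw [eta, if_neg he]
    rw [heta]
    have hBW : |∑ y ∈ B, (a - ψ y)| ≤ W := by
      refine (abs_sum_le_sum_abs _ _).trans ?_
      refine (sum_le_sum_of_subset_of_nonneg (inter_subset_right) fun _ _ _ => abs_nonneg _).trans ?_
      refine (sum_im_le (g := fun y => |a - ψ y|) (fun y => abs_nonneg _) _ _).trans ?_
      exact sum_le_sum fun k _ => abs_sub _ _
    have hdj : 0 < d - j := by linarith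
    have b1 : |(∑ y ∈ B, (a - ψ y)) / (Av G P j x).card| ≤ 8 / d * W := by
      rw [abs_div, abs_of_pos hA, div_le_iff₀ hA]
      have : 1 ≤ 8 / d * (Av G P j x).card := by
        rw [div_mul_eq_mul_div, le_div_iff₀ hd]; linarith
      nlinarith
    have b2 : |1/(d-j) * T| ≤ 2 / d * W := by
      rw [abs_mul, abs_of_pos (by positivity)]
      have : 1/(d-j) ≤ 2/d := by
        rw [div_le_div_iff₀ hdj hd]; linarith
      gcongr
    have b3 := abs_sub ((∑ y ∈ B, (a - ψ y)) / (Av G P j x).card) (1/(d-j) * T)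
    have b4 : 8 / d * W + 2 / d * W = 10 / d * (W * 1) := by ring
    have b5 : 10 / d * (W * 1) ≤ 10 / d * (W * (|rho G d (x (P j))| + 1)) := by
      gcongr
      linarith [abs_nonneg (rho G d (x (P j)))]
    linarith

end hyp
end
end TC

namespace TC
open Finset
open scoped Classical
noncomputable section

variable {β : Type} [Fintype β]

theorem neg_log_ge {u : ℝ} (h0 : 0 < u) (h5 : u ≤ 5) : (1-u) + (1-u)^2/11 ≤ -Real.log u := by
  obtain ⟨v, hv, rfl⟩ : ∃ v : ℝ, 0 < v ∧ u = v^2 :=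
    ⟨√u, Real.sqrt_pos.2 h0, (Real.sq_sqrt h0.le).symm⟩
  rw [Real.log_pow]
  have h1 := Real.log_le_sub_one_of_pos hv
  have h2 : v ≤ 2.25 := by nlinarith
  have h3 : (v+1)^2 ≤ 11 := by nlinarith
  push_cast
  nlinarith [mul_nonneg (sq_nonneg (v-1)) (sub_nonneg.2 h3)]

theorem log_base {d D j : ℝ} (hj : 0 ≤ j) (hd : 160 * (j+1) ≤ d) (hD : d/4 ≤ D) :
    d/(d-j) * (1 - d/D) + (1-d/D)^2/16 ≤ Real.log ((D-j)/(d-j)) := by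
  have a1 : 0 < d - j := by linarith
  have a2 : 0 < D - j := by linarith
  have a3 : 0 < D := by linarith
  have a4 : 0 < d := by linarith
  have h := neg_log_ge (u := (d-j)/(D-j)) (by positivity) (by
    rw [div_le_iff₀ a2]; linarith)
  rw [← Real.log_inv, inv_div] at h
  refine le_trans ?_ h
  set r := 1 - d/D with hr
  have e1 : 1 - (d-j)/(D-j) = d/(d-j) * r - r^2 * (j*D/((D-j)*(d-j))) := by
    rw [hr]; field_simp; ring
  have e2 : 1 - (d-j)/(D-j) = r * (D/(D-j)) := by
    rw [hr]; field_simp; ring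
  have e3 : 1 ≤ D/(D-j) := by rw [le_div_iff₀ a2]; linarith
  have e4 : r^2 ≤ (1 - (d-j)/(D-j))^2 := by
    rw [e2, mul_pow]
    nlinarith [sq_nonneg r, mul_nonneg (sq_nonneg r) (by nlinarith : 0 ≤ (D/(D-j))^2 - 1)]
  have e5 : j*D/((D-j)*(d-j)) ≤ 1/40 := by
    rw [div_le_div_iff₀ (by positivity) (by norm_num)]
    have : D/2 ≤ D - j := by linarith
    have : 80 * j ≤ d - j := by linarith
    nlinarith [mul_le_mul ‹D/2 ≤ D - j› this (by positivity) (by positivity)]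
  have e6 := mul_le_mul_of_nonneg_left e5 (sq_nonneg r)
  have e7 := sq_nonneg r
  rw [e1] at e4 ⊢
  linarith

theorem scalar_bound {s α γ r e : ℝ} (hs : 1 ≤ s) (he : e^2 = e) :
    1/s^2 * ((α+γ)*(r+e)) ≤ 2/s*(α^2+γ^2+r^2) + 1/s^3*e := by
  have hs0 : 0 < s := by linarith
  have e1 : 1/s^2 * ((α+γ)*(r+e)) = (s * ((α+γ)*(r+e)))/s^3 := by field_simp
  have e2 : 2/s*(α^2+γ^2+r^2) + 1/s^3*e = (2*s^2*(α^2+γ^2+r^2) + e)/s^3 := by field_simp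
  rw [e1, e2]
  apply div_le_div_of_nonneg_right _ (by positivity)
  have f1 : s * ((α+γ)*e) ≤ s^2*(α^2+γ^2) + e := by
    nlinarith [sq_nonneg (s*α - e/2), sq_nonneg (s*γ - e/2)]
  have f2 : s * ((α+γ)*r) ≤ s * (α^2+γ^2+r^2) := by
    apply mul_le_mul_of_nonneg_left _ hs0.le
    nlinarith [sq_nonneg (α-r/2), sq_nonneg (γ-r/2)]
  have f3 : s * (α^2+γ^2+r^2) ≤ s^2 * (α^2+γ^2+r^2) := by
    apply mul_le_mul_of_nonneg_right _ (by positivity)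
    nlinarith
  nlinarith [mul_nonneg (sq_nonneg s) (sq_nonneg r)]

section hyp
variable {G : SimpleGraph β} {P : ℕ → ℕ} {t : ℕ} {d : ℝ}

theorem Hyp.log_step (H : Hyp G P t d) (hd : 160 * ((t:ℝ)+1) ≤ d) (j : ℕ) (h1 : 1 ≤ j) (hj : j ≤ t) (x : ℕ → β) :
    d/(d-j) * rho G d (x (P j)) + (rho G d (x (P j)))^2/16 + eta G P j x / G.degree (x (P j)) ≤
      Real.log ((Av G P j x).card / (d-j)) := by
  have hjt : (j:ℝ) ≤ t := by exact_mod_cast hj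
  have h1' : (1:ℝ) ≤ j := by exact_mod_cast h1
  have hb := log_base (d := d) (D := G.degree (x (P j))) (j := j) (by positivity) (by linarith)
    (H.hmin _)
  have hdj : 0 < d - j := by linarith
  have hD := H.degt (x (P j))
  have hDj : 0 < (G.degree (x (P j)) : ℝ) - j := by linarith
  have hD0 := H.degpos (x (P j))
  rw [rho]
  by_cases he : (Av G P j x).card + j = G.degree (x (P j))
  · have hAc : ((Av G P j x).card : ℝ) = G.degree (x (P j)) - j := by
      rw [← he]; push_cast; ring
    rw [eta, if_pos he, hAc]
    simpa using hb
  · have hge : (G.degree (x (P j)) : ℝ) - j + 1 ≤ (Av G P j x).card := by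
      have := H.card_ge j x
      have : G.degree (x (P j)) + 1 ≤ (Av G P j x).card + j := by omega
      have : (G.degree (x (P j)) : ℝ) + 1 ≤ (Av G P j x).card + j := by exact_mod_cast this
      linarith
    rw [eta, if_neg he]
    set A : ℝ := ((Av G P j x).card : ℝ)
    set D : ℝ := (G.degree (x (P j)) : ℝ)
    have hA : 0 < A := by linarith
    have e1 : A / (d-j) = ((D-j)/(d-j)) * (A/(D-j)) := by field_simp
    rw [e1, Real.log_mul (by positivity) (by positivity)]
    have e2 := Real.one_sub_inv_le_log_of_pos (x := A/(D-j)) (by positivity)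
    have e3 : 1 / D ≤ 1 - (A/(D-j))⁻¹ := by
      rw [inv_div]
      have : (D-j)/A ≤ (D-1)/D := by
        rw [div_le_div_iff₀ hA hD0]
        nlinarith
      have : (D-1)/D = 1 - 1/D := by field_simp
      linarith
    linarith

theorem Hyp.eta_nonneg (H : Hyp G P t d) (j : ℕ) (x : ℕ → β) : 0 ≤ eta G P j x := by
  rw [eta]; split_ifs <;> norm_num

theorem Hyp.E_abs (H : Hyp G P t d) (F : (ℕ → β) → ℝ) : |E G P d t F| ≤ E G P d t (fun x => |F x|) := by
  refine (abs_sum_le_sum_abs _ _).trans (le_of_eq ?_)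
  refine sum_congr rfl fun x _ => ?_
  rw [abs_mul, abs_of_pos (H.wt_pos t le_rfl x)]

theorem Hyp.E_nonneg (H : Hyp G P t d) {F : (ℕ → β) → ℝ} (h : ∀ x, 0 ≤ F x) : 0 ≤ E G P d t F :=
  sum_nonneg fun x _ => mul_nonneg (H.wt_pos t le_rfl x).le (h x)

theorem Hyp.M_sq_nonneg (H : Hyp G P t d) (ψ : β → ℝ) : 0 ≤ M G d (fun v => (ψ v)^2) := by
  refine sum_nonneg fun v _ => mul_nonneg ?_ (sq_nonneg _)
  have := H.npos
  have := H.dpos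
  positivity

theorem Hyp.err (H : Hyp G P t d) (i : ℕ) (hi : i ≤ t) (ψ : β → ℝ) (h0 : M G d ψ = 0) {K : ℝ}
    (hS : M G d (fun v => (ψ v)^2) ≤ M G d (fun v => (rho G d v)^2))
    (hK : K = M G d (fun v => (rho G d v)^2) / √d +
      (∑ j ∈ range t, E G P d t (eta G P j)) / √d^3) :
    |E G P d t (fun x => ψ (x i))| ≤ (60 * 2^t * (t+1)) * (2*t+4)^i * K := by
  set S := M G d (fun v => (rho G d v)^2) with hSdef
  have hd := H.dpos
  have hd16 := H.hd
  have hs2 : √d^2 = d := Real.sq_sqrt hd.le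
  have ht0 : (0:ℝ) ≤ t := by positivity
  have hs1 : 1 ≤ √d := by rw [Real.one_le_sqrt]; linarith
  have hs0 : 0 < √d := by linarith
  have hS0 : 0 ≤ S := H.M_sq_nonneg _
  have hE0 : ∀ j, 0 ≤ E G P d t (eta G P j) := fun j => H.E_nonneg (H.eta_nonneg j)
  have hK0 : 0 ≤ K := by
    rw [hK]
    have := sum_nonneg fun j (_ : j ∈ range t) => hE0 j
    positivity
  induction i using Nat.strong_induction_on generalizing ψ with
  | _ i ih =>
  rcases i with _ | j
  · rw [H.E_x0, h0]
    simp only [abs_zero]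
    positivity
  have hPj := H.hP j
  have hjt : (j:ℝ) + 1 ≤ t := by exact_mod_cast hi
  set C : ℝ := 60 * 2^t * (t+1) with hC
  set L : ℝ := 2*t+4 with hL
  have hL1 : 1 ≤ L := by rw [hL]; linarith
  have hC0 : 0 ≤ C := by positivity
  have hLj : ∀ k ≤ j, C * L^k * K ≤ C * L^j * K := by
    intro k hk
    have := pow_le_pow_right₀ hL1 hk
    gcongr
  set B := C * L^j * K with hB
  have hB0 : 0 ≤ B := by positivity
  -- induction hypotheses
  have i1 : |E G P d t (fun x => av G ψ (x (P j)))| ≤ B :=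
    (ih (P j) (by omega) (by omega) (av G ψ) (by rw [H.M_av, h0]) (H.M_sq_av ψ hS)).trans
      (hLj _ hPj)
  have i2 : ∀ k ≤ j, |E G P d t (fun x => ψ (x k))| ≤ B := fun k hk =>
    (ih k (by omega) (by omega) ψ h0 hS).trans (hLj k hk)
  -- split
  set R : (ℕ → β) → ℝ := fun x => (∑ y ∈ Av G P j x, ψ y) / (Av G P j x).card - av G ψ (x (P j))
      - (1/(d-j)) * ∑ k ∈ (range (j+1)).erase (P j), (av G ψ (x (P j)) - ψ (x k)) with hR
  have hsplit : E G P d t (fun x => ψ (x (j+1))) = E G P d t (fun x => av G ψ (x (P j))) +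
      (1/(d-j)) * ∑ k ∈ (range (j+1)).erase (P j), (E G P d t (fun x => av G ψ (x (P j)))
        - E G P d t (fun x => ψ (x k))) + E G P d t R := by
    rw [H.E_step j (by omega)]
    simp_rw [← E_sub]
    rw [← E_sum, ← E_mul, ← E_add, ← E_add]
    congr 1
    funext x
    rw [hR]
    ring
  have hRle : |E G P d t R| ≤ C * K := by
    refine (H.E_abs R).trans ?_
    have hpt : ∀ x, |R x| ≤ 10 * ∑ k ∈ range (j+1), (2/√d * ((av G ψ (x (P j)))^2 + (ψ (x k))^2
        + (rho G d (x (P j)))^2) + 1/√d^3 * eta G P j x) := by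
      intro x
      refine (H.pointwise j (by omega) x ψ).trans ?_
      rw [div_eq_mul_one_div, mul_assoc, sum_mul, mul_sum]
      refine mul_le_mul_of_nonneg_left (sum_le_sum fun k _ => ?_) (by norm_num)
      have := scalar_bound (s := √d) (α := |av G ψ (x (P j))|) (γ := |ψ (x k)|)
        (r := |rho G d (x (P j))|) (e := eta G P j x) hs1 (by rw [eta]; split_ifs <;> norm_num)
      rw [sq_abs, sq_abs, sq_abs, hs2] at this
      exact this
    refine (H.E_mono hpt).trans ?_
    rw [E_mul, E_sum]
    have hk : ∀ k ∈ range (j+1), E G P d t (fun x => 2/√d * ((av G ψ (x (P j)))^2 + (ψ (x k))^2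
        + (rho G d (x (P j)))^2) + 1/√d^3 * eta G P j x) ≤ 6 * 2^t * K := by
      intro k hk
      simp at hk
      rw [E_add, E_mul, E_mul, E_add, E_add]
      have q1 := H.E_sq (P j) (by omega) (av G ψ) (H.M_sq_av ψ hS)
      have q2 := H.E_sq k (by omega) ψ hS
      have q3 := H.E_sq (P j) (by omega) (rho G d) (le_refl S)
      have q4 : E G P d t (eta G P j) ≤ ∑ j ∈ range t, E G P d t (eta G P j) :=
        single_le_sum (f := fun j => E G P d t (eta G P j)) (fun j _ => hE0 j)
          (by simp; omega)
      have q5 : (1:ℝ) ≤ 2^t := one_le_pow₀ (by norm_num)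
      have q6 := sum_nonneg fun j (_ : j ∈ range t) => hE0 j
      calc _ ≤ 2/√d * (2^t * S + 2^t * S + 2^t * S) +
            1/√d^3 * ∑ j ∈ range t, E G P d t (eta G P j) := by gcongr
        _ ≤ 2/√d * (2^t * S + 2^t * S + 2^t * S) +
            6 * 2^t * (1/√d^3 * ∑ j ∈ range t, E G P d t (eta G P j)) := by
          have : 0 ≤ 1/√d^3 * ∑ j ∈ range t, E G P d t (eta G P j) := by positivity
          nlinarith
        _ = 6 * 2^t * K := by rw [hK]; ring
    have := sum_le_sum hk
    rw [sum_const, card_range, nsmul_eq_mul] at this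
    calc _ ≤ 10 * ((↑(j+1):ℝ) * (6 * 2^t * K)) := by linarith
      _ ≤ 10 * ((t+1) * (6 * 2^t * K)) := by
        push_cast
        gcongr
        linarith
      _ = C * K := by rw [hC]; ring
  have hmid : |(1/(d-j)) * ∑ k ∈ (range (j+1)).erase (P j), (E G P d t (fun x => av G ψ (x (P j)))
        - E G P d t (fun x => ψ (x k)))| ≤ (2*t+2) * B := by
    have hdj : 1 ≤ d - j := by linarith
    rw [abs_mul, abs_of_pos (by positivity)]
    have m1 : 1/(d-j) ≤ 1 := by rw [div_le_one (by linarith)]; exact hdj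
    have m2 : |∑ k ∈ (range (j+1)).erase (P j), (E G P d t (fun x => av G ψ (x (P j)))
        - E G P d t (fun x => ψ (x k)))| ≤ (t+1) * (2*B) := by
      refine (abs_sum_le_sum_abs _ _).trans ?_
      have : ∀ k ∈ (range (j+1)).erase (P j), |E G P d t (fun x => av G ψ (x (P j)))
        - E G P d t (fun x => ψ (x k))| ≤ 2 * B := by
        intro k hk
        have hk' := mem_range.1 (mem_of_mem_erase hk)
        refine (abs_sub _ _).trans ?_
        linarith [i2 k (by omega)]
      refine (sum_le_sum this).trans ?_
      rw [sum_const, nsmul_eq_mul]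
      have hc : (((range (j+1)).erase (P j)).card : ℝ) ≤ t + 1 := by
        have := card_erase_le (s := range (j+1)) (a := P j)
        rw [card_range] at this
        have : (((range (j+1)).erase (P j)).card : ℝ) ≤ (j+1:ℕ) := by exact_mod_cast this
        push_cast at this
        linarith
      gcongr
    calc _ ≤ 1 * ((t+1) * (2*B)) := by gcongr
      _ = _ := by ring
  rw [hsplit]
  refine (abs_add_le _ _).trans ?_
  have := abs_add_le (E G P d t (fun x => av G ψ (x (P j)))) ((1/(d-j)) * ∑ k ∈ (range (j+1)).erase (P j), (E G P d t (fun x => av G ψ (x (P j)))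
        - E G P d t (fun x => ψ (x k))))
  have hfin : C * K ≤ B := by
    have := one_le_pow₀ (n := j) hL1
    rw [hB]
    have hCK : 0 ≤ C * K := by positivity
    nlinarith
  have : C * L^(j+1) * K = (2*t+4) * B := by rw [hB, pow_succ, hL]; ring
  rw [this]
  linarith

end hyp
end
end TC

namespace TC
open Finset
open scoped Classical
noncomputable section

variable {β : Type} [Fintype β]

def Y (G : SimpleGraph β) (P : ℕ → ℕ) (t : ℕ) (d : ℝ) (x : ℕ → β) : ℝ :=
  ∏ j ∈ Ico 1 t, (((Av G P j x).card : ℝ) / (d - j))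

def Cb (t : ℕ) : ℝ := 60 * 2^t * (t+1) * (2*t+4)^t

def Lam (t : ℕ) : ℝ := 64 * t * Cb t * (1 + t * 2^t) + 8 * t * Cb t

section hyp
variable {G : SimpleGraph β} {P : ℕ → ℕ} {t : ℕ} {d : ℝ}

theorem Hyp.Av_zero (H : Hyp G P t d) (x : ℕ → β) : Av G P 0 x = G.neighborFinset (x 0) := by
  have : P 0 = 0 := by have := H.hP 0; omega
  rw [Av, this]
  ext y
  simp only [mem_sdiff, SimpleGraph.mem_neighborFinset, zero_add, range_one, image_singleton,
    mem_singleton, and_iff_left_iff_imp]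
  intro h
  exact h.ne'

theorem Hyp.E_x1 (H : Hyp G P t d) (ht : 1 ≤ t) (ψ : β → ℝ) : E G P d t (fun x => ψ (x 1)) = M G d ψ := by
  rw [← H.M_av, ← H.E_x0]
  have := H.E_step 0 (by omega) ψ
  rw [zero_add] at this
  rw [this]
  congr 1
  funext x
  rw [H.Av_zero, av, SimpleGraph.card_neighborFinset_eq_degree]

theorem Hyp.eta_zero_zero (H : Hyp G P t d) (x : ℕ → β) : eta G P 0 x = 0 := by
  have : P 0 = 0 := by have := H.hP 0; omega
  rw [eta, if_pos]
  rw [H.Av_zero, this, SimpleGraph.card_neighborFinset_eq_degree, add_zero]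

theorem Hyp.main_lower (H : Hyp G P t d) (hd : 160 * ((t:ℝ)+1) ≤ d) (hL : Lam t ≤ √d) (ht : 2 ≤ t) (hP1 : P 1 = 1) :
    M G d (fun v => (rho G d v)^2) / 32 +
      (∑ j ∈ Ico 1 t, E G P d t (fun x => eta G P j x / G.degree (x (P j)))) / 2 ≤
    E G P d t (fun x => ∑ j ∈ Ico 1 t, Real.log ((Av G P j x).card / (d-j))) := by
  set S := M G d (fun v => (rho G d v)^2) with hS
  set Q := ∑ j ∈ Ico 1 t, E G P d t (fun x => eta G P j x / G.degree (x (P j))) with hQ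
  set Hs := ∑ j ∈ range t, E G P d t (eta G P j) with hHs
  set K := S / √d + Hs / √d^3 with hK
  have hd0 := H.dpos
  have ht0 : (0:ℝ) ≤ t := by positivity
  have hs2 : √d^2 = d := Real.sq_sqrt hd0.le
  have hs1 : 1 ≤ √d := by rw [Real.one_le_sqrt]; linarith
  have hs0 : 0 < √d := by linarith
  have hS0 : 0 ≤ S := H.M_sq_nonneg _
  have hCb : 0 ≤ Cb t := by rw [Cb]; positivity
  have hHs0 : 0 ≤ Hs := sum_nonneg fun j _ => H.E_nonneg (H.eta_nonneg j)
  have hK0 : 0 ≤ K := by positivity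
  have hQ0 : 0 ≤ Q := sum_nonneg fun j _ => H.E_nonneg fun x =>
    div_nonneg (H.eta_nonneg j x) (H.degpos _).le
  have herr : ∀ i ≤ t, |E G P d t (fun x => rho G d (x i))| ≤ Cb t * K := by
    intro i hi
    refine (H.err i hi (rho G d) H.M_rho le_rfl hK).trans ?_
    rw [Cb]
    have : (1:ℝ) ≤ 2*t+4 := by linarith
    have := pow_le_pow_right₀ this hi
    gcongr
  have hPt : ∀ j ∈ Ico 1 t, P j ≤ t := by
    intro j hj
    have := H.hP j
    simp at hj
    omega
  -- bound of the defect sum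
  have hHs' : Hs / d ≤ 2 * Q + t * 2^t * S := by
    have e1 : Hs = ∑ j ∈ Ico 1 t, E G P d t (eta G P j) := by
      rw [hHs, range_eq_Ico, sum_eq_sum_Ico_succ_bot (by omega)]
      have : eta G P 0 = fun _ => 0 := by funext x; exact H.eta_zero_zero x
      rw [this]
      simp [E]
    have e2 : ∀ j ∈ Ico 1 t, E G P d t (eta G P j) / d ≤
        2 * E G P d t (fun x => eta G P j x / G.degree (x (P j))) + 2^t * S := by
      intro j hj
      have q := H.E_sq (P j) (hPt j hj) (rho G d) (le_refl S)
      have : E G P d t (fun x => 1/d * eta G P j x) ≤ E G P d t (fun x =>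
          2 * (eta G P j x / G.degree (x (P j))) + (rho G d (x (P j)))^2) := by
        apply H.E_mono
        intro x
        have hD := H.degpos (x (P j))
        have h1 : 1/d * eta G P j x - eta G P j x / G.degree (x (P j)) =
          1/d * (eta G P j x * rho G d (x (P j))) := by
          rw [rho]; field_simp
        have h2 : (eta G P j x)^2 = eta G P j x := by rw [eta]; split_ifs <;> norm_num
        have h3 := H.eta_nonneg j x
        have h4 : eta G P j x * rho G d (x (P j)) ≤ (eta G P j x + (rho G d (x (P j)))^2)/2 := by
          nlinarith [sq_nonneg (eta G P j x - rho G d (x (P j)))]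
        have h5 : 1/d * (eta G P j x * rho G d (x (P j))) ≤
          1/d * ((eta G P j x + (rho G d (x (P j)))^2)/2) := by gcongr
        have h6 : 1/d ≤ 1 := by rw [div_le_one hd0]; linarith
        have h7 := mul_le_mul_of_nonneg_right h6 (sq_nonneg (rho G d (x (P j))))
        nlinarith
      rw [E_add, E_mul, E_mul] at this
      rw [div_eq_mul_one_div, mul_comm]
      linarith
    rw [e1, sum_div]
    refine (sum_le_sum e2).trans ?_
    rw [sum_add_distrib, ← mul_sum, sum_const, nsmul_eq_mul, Nat.card_Ico]
    have : ((t - 1 : ℕ) : ℝ) ≤ t := by exact_mod_cast Nat.sub_le t 1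
    have h9 : 0 ≤ 2^t * S := by positivity
    nlinarith
  have hKle : K * √d ≤ (1 + t*2^t) * S + 2 * Q := by
    have : K * √d = S + Hs / √d^2 := by rw [hK]; field_simp
    rw [this, hs2]
    linarith
  have hkey : 2 * t * (Cb t * K) ≤ S/32 + Q/2 := by
    have h1 : 2 * t * (Cb t * K) * √d ≤ 2 * t * Cb t * ((1 + t*2^t) * S + 2 * Q) := by
      have := mul_le_mul_of_nonneg_left hKle (by positivity : 0 ≤ 2 * t * Cb t)
      linarith
    have h2 : 2 * t * Cb t * ((1 + t*2^t) * S + 2 * Q) ≤ (S/32 + Q/2) * Lam t := by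
      rw [Lam]
      have h3 : 0 ≤ t * Cb t := by positivity
      have h4 : 0 ≤ t * Cb t * (1 + t * 2^t) := by positivity
      nlinarith [mul_nonneg h3 hS0, mul_nonneg h4 hQ0]
    have h3 : (S/32 + Q/2) * Lam t ≤ (S/32 + Q/2) * √d := by gcongr
    exact le_of_mul_le_mul_right (h1.trans (h2.trans h3)) hs0
  -- lower bound
  have hlow : E G P d t (fun x => ∑ j ∈ Ico 1 t, (d/(d-j) * rho G d (x (P j)) +
      (1/16) * (rho G d (x (P j)))^2 + eta G P j x / G.degree (x (P j)))) ≤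
      E G P d t (fun x => ∑ j ∈ Ico 1 t, Real.log ((Av G P j x).card / (d-j))) := by
    apply H.E_mono
    intro x
    refine sum_le_sum fun j hj => ?_
    simp at hj
    have := H.log_step hd j hj.1 hj.2.le x
    linarith
  refine le_trans ?_ hlow
  rw [E_sum]
  simp_rw [E_add, E_mul]
  rw [sum_add_distrib, sum_add_distrib, ← hQ]
  have hA : -(2 * t * (Cb t * K)) ≤ ∑ j ∈ Ico 1 t, d/(d-j) * E G P d t (fun x => rho G d (x (P j))) := by
    have : ∀ j ∈ Ico 1 t, -(2 * (Cb t * K)) ≤ d/(d-j) * E G P d t (fun x => rho G d (x (P j))) := by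
      intro j hj
      have h1 := herr (P j) (hPt j hj)
      have hj' : (j:ℝ) ≤ t := by
        simp at hj
        exact_mod_cast hj.2.le
      have hdj : 0 < d - j := by linarith
      have h2 : d/(d-j) ≤ 2 := by rw [div_le_iff₀ hdj]; linarith
      have h3 : 0 ≤ d/(d-j) := by positivity
      have h4 := (abs_le.1 h1).1
      have h5 : 0 ≤ Cb t * K := by positivity
      nlinarith
    refine le_trans ?_ (sum_le_sum this)
    rw [sum_const, nsmul_eq_mul, Nat.card_Ico]
    have : ((t - 1 : ℕ) : ℝ) ≤ t := by exact_mod_cast Nat.sub_le t 1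
    have h9 : 0 ≤ Cb t * K := by positivity
    nlinarith
  have hB : S/16 ≤ ∑ j ∈ Ico 1 t, 1/16 * E G P d t (fun x => (rho G d (x (P j)))^2) := by
    have h1 : 1/16 * E G P d t (fun x => (rho G d (x (P 1)))^2) ≤
        ∑ j ∈ Ico 1 t, 1/16 * E G P d t (fun x => (rho G d (x (P j)))^2) :=
      single_le_sum (f := fun j => 1/16 * E G P d t (fun x => (rho G d (x (P j)))^2))
        (fun j _ => mul_nonneg (by norm_num) (H.E_nonneg fun x => sq_nonneg _)) (by simp; omega)
    rw [hP1, H.E_x1 (by omega) (fun v => (rho G d v)^2)] at h1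
    linarith
  linarith

theorem Hyp.card_X (H : Hyp G P t d) (ht : 1 ≤ t) : ((X G P t).card : ℝ) =
    Fintype.card β * (∏ j ∈ range t, (d - (j:ℝ))) * E G P d t (Y G P t d) := by
  rw [E, mul_sum, card_eq_sum_ones]
  push_cast
  refine sum_congr rfl fun x hx => ?_
  have hd0 := H.dpos
  have hd16 := H.hd
  have hn := H.npos
  have hD := H.degpos (x 0)
  have ht0 : 0 < t := by omega
  rw [wt, Y, range_eq_Ico, prod_eq_prod_Ico_succ_bot ht0 (fun j => d - (j:ℝ)),
    prod_eq_prod_Ico_succ_bot ht0 (fun j => ((Av G P j x).card : ℝ)⁻¹), H.Av_zero, SimpleGraph.card_neighborFinset_eq_degree]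
  have : (∏ j ∈ Ico (0+1) t, (d - (j:ℝ))) * ((∏ j ∈ Ico (0+1) t, ((Av G P j x).card : ℝ)⁻¹) *
      ∏ j ∈ Ico 1 t, (((Av G P j x).card : ℝ) / (d - j))) = 1 := by
    rw [← prod_mul_distrib, ← prod_mul_distrib]
    apply prod_eq_one
    intro j hj
    simp at hj
    have h1 := H.card_pos j hj.2.le x
    have hj' : (j:ℝ) ≤ t := by exact_mod_cast hj.2.le
    have hdj : 0 < d - j := by
      have : (0:ℝ) ≤ t := by positivity
      linarith
    field_simp
  calc (1:ℝ) = (∏ j ∈ Ico (0+1) t, (d - (j:ℝ))) * ((∏ j ∈ Ico (0+1) t, ((Av G P j x).card : ℝ)⁻¹) *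
      ∏ j ∈ Ico 1 t, (((Av G P j x).card : ℝ) / (d - j))) := this.symm
    _ = _ := by
      push_cast
      field_simp
      ring

theorem Hyp.forward (H : Hyp G P t d) (hd : 160 * ((t:ℝ)+1) ≤ d) (hL : Lam t ≤ √d) (ht : 3 ≤ t) (hP1 : P 1 = 1)
    (hP2 : P 2 = 2)
    (heq : ((X G P t).card : ℝ) = Fintype.card β * (∏ j ∈ range t, (d - (j:ℝ)))) :
    (∀ v, (G.degree v : ℝ) = d) ∧ ∀ u v z, G.Adj u v → G.Adj v z → u ≠ z → G.Adj u z := by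
  have hd0 := H.dpos
  have hn := H.npos
  have hdj : ∀ j < t, 0 < d - (j:ℝ) := by
    intro j hj
    have hj' : (j:ℝ) ≤ t := by exact_mod_cast hj.le
    have : (0:ℝ) ≤ t := by positivity
    linarith
  have hprod : 0 < ∏ j ∈ range t, (d - (j:ℝ)) := prod_pos fun j hj => hdj j (by simpa using hj)
  have hEY : E G P d t (Y G P t d) = 1 := by
    have h := H.card_X (by omega)
    rw [heq] at h
    have hne : (Fintype.card β : ℝ) * (∏ j ∈ range t, (d - (j:ℝ))) ≠ 0 := by positivity
    exact mul_left_cancel₀ hne (by rw [← h, mul_one])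
  have hlog : E G P d t (fun x => ∑ j ∈ Ico 1 t, Real.log ((Av G P j x).card / (d-j))) ≤ 0 := by
    have : E G P d t (fun x => ∑ j ∈ Ico 1 t, Real.log ((Av G P j x).card / (d-j))) ≤
        E G P d t (fun x => Y G P t d x - 1) := by
      apply H.E_mono
      intro x
      have hpos : ∀ j ∈ Ico 1 t, 0 < ((Av G P j x).card : ℝ) / (d - j) := by
        intro j hj
        simp at hj
        exact div_pos (H.card_pos j hj.2.le x) (hdj j hj.2)
      rw [← Real.log_prod (fun j hj => (hpos j hj).ne')]
      exact Real.log_le_sub_one_of_pos (prod_pos hpos)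
    rw [E_sub, hEY, H.E_one] at this
    linarith
  have hmain := H.main_lower hd hL (by omega) hP1
  have hS0 : 0 ≤ M G d (fun v => (rho G d v)^2) := H.M_sq_nonneg _
  have hterm : ∀ j, 0 ≤ E G P d t (fun x => eta G P j x / G.degree (x (P j))) := fun j =>
    H.E_nonneg fun x => div_nonneg (H.eta_nonneg j x) (H.degpos _).le
  have hQ0 := sum_nonneg fun j (_ : j ∈ Ico 1 t) => hterm j
  have hS : M G d (fun v => (rho G d v)^2) = 0 := by linarith
  have hQ : ∑ j ∈ Ico 1 t, E G P d t (fun x => eta G P j x / G.degree (x (P j))) = 0 := by linarith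
  constructor
  · intro v
    have h1 := (sum_eq_zero_iff_of_nonneg (fun v _ => by
      have := H.degpos v
      positivity)).1 hS v (mem_univ v)
    have hD := H.degpos v
    have h2 : rho G d v = 0 := by
      have h3 : (G.degree v : ℝ) / (Fintype.card β * d) ≠ 0 := by positivity
      have := (mul_eq_zero.1 h1).resolve_left h3
      exact pow_eq_zero_iff (two_ne_zero) |>.1 this
    rw [rho, sub_eq_zero, eq_div_iff hD.ne'] at h2
    linarith
  · intro u v z huv hvz huz
    have h2 := (sum_eq_zero_iff_of_nonneg (fun j _ => hterm j)).1 hQ 2 (by simp; omega)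
    rw [H.E_stable (i := 2) ?_ t (by omega) le_rfl] at h2
    swap
    · intro x x' h
      have h' : x (P 2) = x' (P 2) := h _ (H.hP 2)
      simp only [eta, Dep_Av G H.hP 2 x x' h]
      rw [h']
    have hnn : ∀ x ∈ X G P 2, 0 ≤ wt G P d 2 x * (eta G P 2 x / G.degree (x (P 2))) := fun x _ =>
      mul_nonneg (H.wt_pos 2 (by omega) x).le (div_nonneg (H.eta_nonneg 2 x) (H.degpos _).le)
    set x : ℕ → β := fun k => if k = 1 then v else if k = 2 then z else u with hx
    have hxm : x ∈ X G P 2 := by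
      rw [mem_X H.hP]
      refine ⟨?_, ?_, ?_⟩
      · intro a ha b hb hab
        simp only [Set.mem_Iic] at ha hb
        have := huv.ne
        have := hvz.ne
        interval_cases a <;> interval_cases b <;> simp_all [hx]
      · intro j hj
        have hP0 : P 0 = 0 := by have := H.hP 0; omega
        interval_cases j
        · simp [hP0, hx, huv]
        · simp [hP1, hx, hvz]
      · intro j hj
        simp only [hx]
        rw [if_neg (by omega), if_neg (by omega)]
        simp
    have h3 := (sum_eq_zero_iff_of_nonneg hnn).1 h2 x hxm
    have h4 : eta G P 2 x = 0 := by
      have := (mul_eq_zero.1 h3).resolve_left (H.wt_pos 2 (by omega) x).ne'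
      exact (div_eq_zero_iff.1 this).resolve_right (H.degpos _).ne'
    have h5 : (Av G P 2 x).card + 2 = G.degree (x (P 2)) := by
      by_contra h
      rw [eta, if_neg h] at h4
      norm_num at h4
    have h6 := (H.eta_zero 2 x h5).1
    have h7 : x 0 ∈ ((range (2+1)).erase (P 2)).image x :=
      mem_image.2 ⟨0, by simp [hP2], rfl⟩
    rw [← h6, mem_inter, hP2, SimpleGraph.mem_neighborFinset] at h7
    have := h7.1
    simp [hx] at this
    exact this.symm

theorem Hyp.backward (H : Hyp G P t d) (ht : 1 ≤ t) (k : ℕ) (hk : (k:ℝ) = d)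
    (hc : ∀ c : G.ConnectedComponent, c.supp.ncard = k + 1 ∧ c.supp.Pairwise G.Adj) :
    ((X G P t).card : ℝ) = Fintype.card β * (∏ j ∈ range t, (d - (j:ℝ))) := by
  rw [H.card_X ht]
  have : E G P d t (Y G P t d) = E G P d t (fun _ => 1) := by
    refine sum_congr rfl fun x hx => ?_
    congr 1
    rw [Y]
    apply prod_eq_one
    intro j hj
    simp at hj
    obtain ⟨m1, m2, m3⟩ := (mem_X H.hP t x).1 hx
    have hreach : ∀ i ≤ t, G.connectedComponentMk (x i) = G.connectedComponentMk (x 0) := by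
      intro i hi
      induction i using Nat.strong_induction_on with
      | _ i ih =>
      rcases i with _ | i
      · rfl
      · have hPi := H.hP i
        rw [← ih (P i) (by omega) (by omega)]
        exact (SimpleGraph.ConnectedComponent.connectedComponentMk_eq_of_adj (m2 i (by omega))).symm
    set c := G.connectedComponentMk (x 0) with hcdef
    obtain ⟨c1, c2⟩ := hc c
    have hAv : Av G P j x = c.supp.toFinset \ (range (j+1)).image x := by
      ext y
      simp only [Av, mem_sdiff, SimpleGraph.mem_neighborFinset, Set.mem_toFinset,
        SimpleGraph.ConnectedComponent.mem_supp_iff]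
      have hPj := H.hP j
      have hxp : G.connectedComponentMk (x (P j)) = c := hreach _ (by omega)
      constructor
      · rintro ⟨h1, h2⟩
        refine ⟨?_, h2⟩
        rw [← hxp]
        exact (SimpleGraph.ConnectedComponent.connectedComponentMk_eq_of_adj h1).symm
      · rintro ⟨h1, h2⟩
        refine ⟨?_, h2⟩
        apply c2 hxp h1
        rintro rfl
        exact h2 (mem_image.2 ⟨P j, by simp; omega, rfl⟩)
    have hcard : (Av G P j x).card + (j + 1) = k + 1 := by
      rw [hAv, ← c1, Set.ncard_eq_toFinset_card']
      have hi : ((range (j+1)).image x).card = j + 1 := by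
        rw [card_image_of_injOn, card_range]
        intro a ha b hb hab
        simp at ha hb
        exact m1 (by simp; omega) (by simp; omega) hab
      have hs : (range (j+1)).image x ⊆ c.supp.toFinset → (c.supp.toFinset \ (range (j+1)).image x).card
          + (j+1) = c.supp.toFinset.card := by
        intro h
        have := card_sdiff_add_card_eq_card h
        rwa [hi] at this
      apply hs
      intro y hy
      obtain ⟨i, hi, rfl⟩ := mem_image.1 hy
      simp at hi
      simp only [Set.mem_toFinset, SimpleGraph.ConnectedComponent.mem_supp_iff]
      exact hreach i (by omega)
    have hAc : ((Av G P j x).card : ℝ) = d - j := by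
      have : ((Av G P j x).card : ℝ) + (j+1) = k + 1 := by exact_mod_cast hcard
      linarith
    rw [hAc, div_self]
    have := H.card_pos j hj.2.le x
    rw [hAc] at this
    exact this.ne'
  rw [this, H.E_one, mul_one]

end hyp
end
end TC

namespace TC
open Finset
open scoped Classical

theorem order_exists {α : Type} [Fintype α] (T : SimpleGraph α) (hT : T.Connected) (t : ℕ)
    (hc : Fintype.card α = t + 1) (hd : ∃ u v : α, 3 ≤ T.dist u v) (m : ℕ) (h3 : 3 ≤ m)
    (hm : m ≤ t) : ∃ (e : ℕ → α) (P : ℕ → ℕ), (∀ j, P j ≤ j) ∧ P 1 = 1 ∧ P 2 = 2 ∧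
      Set.InjOn e (Set.Iic m) ∧ ∀ j < m, T.Adj (e (P j)) (e (j+1)) := by
  induction m, h3 using Nat.le_induction with
  | base =>
    obtain ⟨u, v, huv⟩ := hd
    obtain ⟨p, hp, hl⟩ := hT.exists_path_of_dist u v
    refine ⟨p.getVert, id, fun j => le_rfl, rfl, rfl, ?_, ?_⟩
    · refine hp.getVert_injOn.mono ?_
      intro i hi
      simp only [Set.mem_Iic] at hi
      change i ≤ p.length
      omega
    · intro j hj
      change T.Adj (p.getVert j) (p.getVert (j+1))
      exact p.adj_getVert_succ (by omega)
  | succ m hm3 ih =>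
    obtain ⟨e, P, hP, hP1, hP2, hinj, hadj⟩ := ih (by omega)
    set S : Finset α := (range (m+1)).image e with hS
    have hScard : S.card ≤ m + 1 := card_image_le.trans (by simp)
    obtain ⟨z, hz⟩ : ∃ z, z ∉ S := by
      by_contra h
      push Not at h
      have : S = univ := eq_univ_iff_forall.2 h
      rw [this, card_univ] at hScard
      omega
    have h0 : e 0 ∈ S := mem_image.2 ⟨0, by simp, rfl⟩
    obtain ⟨w⟩ := hT.preconnected (e 0) z
    obtain ⟨b, _, hb1, hb2⟩ := w.exists_boundary_dart (S : Set α) (by simpa using h0) (by simpa using hz)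
    obtain ⟨k, hk, hke⟩ := mem_image.1 (mem_coe.1 hb1)
    simp only [mem_range] at hk
    have hb2' : b.toProd.2 ∉ S := fun h => hb2 (mem_coe.2 h)
    have hne : ∀ i ≤ m, e i ≠ b.toProd.2 := fun i hi h =>
      hb2' (mem_image.2 ⟨i, by simp; omega, h⟩)
    refine ⟨Function.update e (m+1) b.toProd.2, Function.update P m k, ?_, ?_, ?_, ?_, ?_⟩
    · intro j
      by_cases hj : j = m
      · subst hj; simp; omega
      · rw [Function.update_of_ne hj]; exact hP j
    · rw [Function.update_of_ne (by omega)]; exact hP1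
    · rw [Function.update_of_ne (by omega)]; exact hP2
    · intro a ha c hc' hac
      simp only [Set.mem_Iic] at ha hc'
      by_cases h1 : a = m+1 <;> by_cases h2 : c = m+1
      · omega
      · subst h1
        rw [Function.update_self, Function.update_of_ne h2] at hac
        exact absurd hac.symm (hne c (by omega))
      · subst h2
        rw [Function.update_self, Function.update_of_ne h1] at hac
        exact absurd hac (hne a (by omega))
      · rw [Function.update_of_ne h1, Function.update_of_ne h2] at hac
        exact hinj (by simp; omega) (by simp; omega) hac
    · intro j hj
      by_cases hjm : j = m
      · subst hjm
        rw [Function.update_self, Function.update_self, Function.update_of_ne (by omega), hke]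
        exact b.adj
      · have := hP j
        rw [Function.update_of_ne hjm, Function.update_of_ne (by omega),
          Function.update_of_ne (by omega)]
        exact hadj j (by omega)

theorem edges_covered {α : Type} [Fintype α] (T : SimpleGraph α) (hT : T.IsTree) (t : ℕ)
    (hc : Fintype.card α = t + 1) (e : ℕ → α) (P : ℕ → ℕ) (hP : ∀ j, P j ≤ j)
    (hinj : Set.InjOn e (Set.Iic t)) (hadj : ∀ j < t, T.Adj (e (P j)) (e (j+1))) (u v : α)
    (huv : T.Adj u v) : ∃ j < t, s(e (P j), e (j+1)) = s(u, v) := by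
  have hcard := hT.card_edgeFinset
  have hsub : (range t).image (fun j => s(e (P j), e (j+1))) ⊆ T.edgeFinset := by
    intro z hz
    obtain ⟨j, hj, rfl⟩ := mem_image.1 hz
    simp only [SimpleGraph.mem_edgeFinset, SimpleGraph.mem_edgeSet]
    exact hadj j (by simpa using hj)
  have hci : ((range t).image (fun j => s(e (P j), e (j+1)))).card = t := by
    rw [card_image_of_injOn, card_range]
    intro a ha b hb hab
    simp only [coe_range, Set.mem_Iio] at ha hb
    have := hP a
    have := hP b
    simp only [Sym2.eq_iff] at hab
    rcases hab with ⟨_, h⟩ | ⟨h1, h2⟩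
    · have := hinj (by simp; omega) (by simp; omega) h
      omega
    · have := hinj (by simp; omega) (by simp; omega) h1
      have := hinj (by simp; omega) (by simp; omega) h2
      omega
  have heq := eq_of_subset_of_card_le hsub (by omega)
  have : s(u, v) ∈ T.edgeFinset := by simpa using huv
  rw [← heq] at this
  obtain ⟨j, hj, h⟩ := mem_image.1 this
  exact ⟨j, by simpa using hj, h⟩

theorem monCount_eq {α β : Type} [Fintype α] [Fintype β] (T : SimpleGraph α) (G : SimpleGraph β)
    (hT : T.IsTree) (t : ℕ)
    (hc : Fintype.card α = t + 1) (e : ℕ → α) (P : ℕ → ℕ) (hP : ∀ j, P j ≤ j)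
    (hinj : Set.InjOn e (Set.Iic t)) (hadj : ∀ j < t, T.Adj (e (P j)) (e (j+1))) :
    monCount T G = (X G P t).card := by
  have hsurj : ∀ a : α, ∃ i ≤ t, e i = a := by
    have : (range (t+1)).image e = univ := by
      apply eq_of_subset_of_card_le (subset_univ _)
      rw [card_univ, hc, card_image_of_injOn, card_range]
      intro a ha b hb hab
      simp only [coe_range, Set.mem_Iio] at ha hb
      exact hinj (by simp; omega) (by simp; omega) hab
    intro a
    have ha : a ∈ (range (t+1)).image e := by rw [this]; simp
    obtain ⟨i, hi, h⟩ := mem_image.1 ha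
    exact ⟨i, by simp at hi; omega, h⟩
  choose idx hidx1 hidx2 using hsurj
  have hidx : ∀ i ≤ t, idx (e i) = i := fun i hi =>
    hinj (by simpa using hidx1 (e i)) (by simpa using hi) (hidx2 (e i))
  have hx : ∀ f : α → β, Function.Injective f → (∀ ⦃u v : α⦄, T.Adj u v → G.Adj (f u) (f v)) →
      (fun i => if i ≤ t then f (e i) else f (e 0)) ∈ X G P t := by
    intro f hf1 hf2
    rw [mem_X hP]
    refine ⟨?_, ?_, ?_⟩
    · intro a ha b hb hab
      simp only [Set.mem_Iic] at ha hb
      simp only [ha, hb, if_true] at hab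
      exact hinj ha hb (hf1 hab)
    · intro j hj
      have := hP j
      simp only [show P j ≤ t by omega, show j + 1 ≤ t by omega, if_true]
      exact hf2 (hadj j hj)
    · intro j hj
      simp only [show ¬ j ≤ t by omega, if_false, Nat.zero_le, if_true]
  have hXc : Nat.card {x // x ∈ X G P t} = (X G P t).card := by simp
  rw [monCount, ← hXc]
  refine Nat.card_eq_of_bijective (fun f => (⟨_, hx f.1 f.2.1 f.2.2⟩ : {x // x ∈ X G P t})) ⟨?_, ?_⟩
  · rintro ⟨f, hf⟩ ⟨g, hg⟩ h
    simp only [Subtype.mk.injEq] at h ⊢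
    funext a
    have := congrFun h (idx a)
    simpa [hidx1 a, hidx2 a] using this
  · rintro ⟨x, hxm⟩
    obtain ⟨h1, h2, h3⟩ := (mem_X hP t x).1 hxm
    refine ⟨⟨fun a => x (idx a), ?_, ?_⟩, ?_⟩
    · intro a b hab
      have := h1 (by simpa using hidx1 a) (by simpa using hidx1 b) hab
      rw [← hidx2 a, ← hidx2 b, this]
    · intro u v huv
      change G.Adj (x (idx u)) (x (idx v))
      obtain ⟨j, hj, hs⟩ := edges_covered T hT t hc e P hP hinj hadj u v huv
      have := hP j
      have hj2 := h2 j hj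
      rcases Sym2.eq_iff.1 hs with ⟨rfl, rfl⟩ | ⟨rfl, rfl⟩
      · rw [hidx (P j) (by omega), hidx (j+1) (by omega)]
        exact hj2
      · rw [hidx (j+1) (by omega), hidx (P j) (by omega)]
        exact hj2.symm
    · apply Subtype.ext
      funext i
      change (if i ≤ t then x (idx (e i)) else x (idx (e 0))) = x i
      split_ifs with hi
      · rw [hidx i hi]
      · rw [hidx 0 (by omega), h3 i (by omega)]

theorem cliques_of {β : Type} [Fintype β] (G : SimpleGraph β) (k : ℕ) (hdeg : ∀ v, G.degree v = k)
    (hadj : ∀ u v z, G.Adj u v → G.Adj v z → u ≠ z → G.Adj u z) :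
    componentsAreCliques G (k + 1) := by
  have hwalk : ∀ u v, G.Walk u v → u = v ∨ G.Adj u v := by
    intro u v w
    induction w with
    | nil => exact Or.inl rfl
    | @cons a b c h w ih =>
      rcases ih with rfl | h'
      · exact Or.inr h
      · by_cases hac : a = c
        · exact Or.inl hac
        · exact Or.inr (hadj a b c h h' hac)
  have hre : ∀ u v, G.connectedComponentMk u = G.connectedComponentMk v → u = v ∨ G.Adj u v := by
    intro u v h
    obtain ⟨w⟩ := SimpleGraph.ConnectedComponent.exact h
    exact hwalk u v w
  intro c
  induction c using SimpleGraph.ConnectedComponent.ind with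
  | _ v =>
  constructor
  · have : (G.connectedComponentMk v).supp = ((insert v (G.neighborFinset v) : Finset β) : Set β) := by
      ext u
      simp only [SimpleGraph.ConnectedComponent.mem_supp_iff, coe_insert, Set.mem_insert_iff, mem_coe,
        SimpleGraph.mem_neighborFinset]
      constructor
      · intro h
        rcases hre u v h with h | h
        · exact Or.inl h
        · exact Or.inr h.symm
      · rintro (rfl | h)
        · rfl
        · exact (SimpleGraph.ConnectedComponent.connectedComponentMk_eq_of_adj h).symm
    rw [this, Set.ncard_coe_finset, card_insert_of_notMem (by simp),
      SimpleGraph.card_neighborFinset_eq_degree, hdeg]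
  · intro a ha b hb hab
    rw [SimpleGraph.ConnectedComponent.mem_supp_iff] at ha hb
    exact (hre a b (ha.trans hb.symm)).resolve_left hab

theorem final (t : ℕ) (α β : Type) [Fintype α] [Fintype β]
      (T : SimpleGraph α) (G : SimpleGraph β)
      (hT : T.IsTree) (hc : Fintype.card α = t + 1)
      (hdist : ∃ u v : α, 3 ≤ T.dist u v)
      (hd0 : 160 * ((t:ℝ)+1) + (Lam t)^2 ≤ avgDeg G)
      (hmin : ∀ v : β, avgDeg G / 4 ≤ (Nat.card (G.neighborSet v) : ℝ)) :
      ((monCount T G : ℝ) = (Fintype.card β : ℝ) * fallFact (avgDeg G) t ↔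
        ∃ k : ℕ, (k : ℝ) = avgDeg G ∧ componentsAreCliques G (k + 1)) := by
  have ht0 : (0:ℝ) ≤ t := by positivity
  have ht : 3 ≤ t := by
    obtain ⟨u, v, huv⟩ := hdist
    obtain ⟨p, hp, hl⟩ := hT.connected.exists_path_of_dist u v
    have := hp.length_lt
    omega
  obtain ⟨e, P, hP, hP1, hP2, hinj, hadj⟩ := order_exists T hT.connected t hc hdist t ht le_rfl
  have hdpos : 0 < avgDeg G := by
    have := sq_nonneg (Lam t)
    linarith
  have hn : 0 < Fintype.card β := by
    by_contra h
    have h0 : Fintype.card β = 0 := by omega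
    rw [avgDeg, h0] at hdpos
    simp at hdpos
  have hsum : ∑ v, (G.degree v : ℝ) = Fintype.card β * avgDeg G := by
    have h1 : (0:ℝ) < Fintype.card β := by exact_mod_cast hn
    have h2 := G.sum_degrees_eq_twice_card_edges
    have h3 : Nat.card G.edgeSet = G.edgeFinset.card := by
      rw [Nat.card_eq_fintype_card, SimpleGraph.edgeFinset_card]
    rw [avgDeg, h3, mul_div_cancel₀ _ h1.ne']
    exact_mod_cast h2
  have hdeg : ∀ v, Nat.card (G.neighborSet v) = G.degree v := by
    intro v
    rw [Nat.card_eq_fintype_card, SimpleGraph.card_neighborSet_eq_degree]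
  have H : Hyp G P t (avgDeg G) := by
    refine ⟨hP, hsum, ?_, ?_, hn⟩
    · intro v
      rw [← hdeg]
      exact hmin v
    · have := sq_nonneg (Lam t)
      linarith
  rw [monCount_eq T G hT t hc e P hP hinj hadj, fallFact]
  constructor
  · intro heq
    obtain ⟨r1, r2⟩ := H.forward (by have := sq_nonneg (Lam t); linarith)
      (Real.le_sqrt_of_sq_le (by linarith)) ht hP1 hP2 heq
    obtain ⟨v⟩ := Fintype.card_pos_iff.1 hn
    refine ⟨G.degree v, r1 v, cliques_of G _ ?_ r2⟩
    intro u
    have := (r1 u).trans (r1 v).symm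
    exact_mod_cast this
  · rintro ⟨k, hk, hcl⟩
    exact H.backward (by omega) k hk hcl

end TC

/-- Lemma 1.3 (equality case): under the minimum degree assumption `δ(G) ≥ d/4`, for trees
of diameter at least 3, equality `|Mon(T,G)| = n·d(d-1)⋯(d-t+1)` holds iff every connected
component of `G` is a complete graph on `d+1` vertices. -/
theorem tree_count_equality_iff_cliques_min_degree (t : ℕ) (ht : 0 < t) :
    ∃ d0 : ℝ, ∀ (α β : Type) [Fintype α] [Fintype β]
      (T : SimpleGraph α) (G : SimpleGraph β),
      T.IsTree → Fintype.card α = t + 1 →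
      (∃ u v : α, 3 ≤ T.dist u v) →
      d0 ≤ avgDeg G →
      (∀ v : β, avgDeg G / 4 ≤ (Nat.card (G.neighborSet v) : ℝ)) →
      ((monCount T G : ℝ) = (Fintype.card β : ℝ) * fallFact (avgDeg G) t ↔
        ∃ k : ℕ, (k : ℝ) = avgDeg G ∧ componentsAreCliques G (k + 1)) := by
  refine ⟨160 * ((t:ℝ)+1) + (TC.Lam t)^2, ?_⟩
  intro α β _ _ T G hT hc hdist hd0 hmin
  exact TC.final t α β T G hT hc hdist hd0 hmin
end

section
/- Let t ≥ 1 be an integer, let T be a tree with t edges, and let G be a finite simple graph on n vertices with average degree d = 2|E(G)|/n ≥ t(t−1). Then the number of injective homomorphisms from T to G is at least n·(d − t(t−1))^t. -/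
open Classical in
/-- Degree of a vertex, as a real number. -/
noncomputable def dgr {β : Type} [Fintype β] (G : SimpleGraph β) (x : β) : ℝ :=
  ∑ y, if G.Adj x y then (1 : ℝ) else 0

open Classical in
/-- The (unnormalised) tree random walk weight on maps `α → β`. -/
structure TreeWt {α β : Type} [Fintype α] [DecidableEq α] [Fintype β] (T : SimpleGraph α) (G : SimpleGraph β)
    (t : ℕ) (w : (α → β) → ℝ) (k : α → ℕ) (r : α) : Prop where
  nonneg : ∀ f, 0 ≤ w f
  hom : ∀ f, w f ≠ 0 → ∀ u v, T.Adj u v → G.Adj (f u) (f v)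
  marg : ∀ v x, ∑ f, (if f v = x then w f else 0) = dgr G x
  prod : ∀ f, w f ≠ 0 → w f * ∏ v, dgr G (f v) ^ k v = dgr G (f r)
  ksum : ∑ v, k v = t
  kroot : 1 ≤ t → 1 ≤ k r
  ninj : ∑ f, (if Function.Injective f then 0 else w f) ≤ Fintype.card β * ((t : ℝ) * ((t : ℝ) - 1))

theorem dgr_nonneg {β : Type} [Fintype β] (G : SimpleGraph β) (x : β) : 0 ≤ dgr G x := by
  classical
  unfold dgr
  exact Finset.sum_nonneg fun y _ => by split_ifs <;> norm_num

section
variable {α β : Type} [Fintype α] [DecidableEq α] [Fintype β] {T : SimpleGraph α} {G : SimpleGraph β}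
    {t : ℕ} {w : (α → β) → ℝ} {k : α → ℕ} {r : α}

theorem TreeWt.dgr_ne (h : TreeWt T G t w k r) (f : α → β) (hf : w f ≠ 0) (v : α) :
    dgr G (f v) ≠ 0 := by
  classical
  intro h0
  have h1 := h.marg v (f v)
  rw [h0, Finset.sum_eq_zero_iff_of_nonneg] at h1
  · have := h1 f (Finset.mem_univ _)
    simp at this
    exact hf this
  · intro g _
    split_ifs
    · exact h.nonneg g
    · exact le_rfl

theorem TreeWt.sum_fun (h : TreeWt T G t w k r) (v : α) (g : β → ℝ) :
    ∑ f, w f * g (f v) = ∑ x, dgr G x * g x := by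
  classical
  simp_rw [← h.marg v, Finset.sum_mul]
  rw [Finset.sum_comm]
  refine Finset.sum_congr rfl fun f _ => ?_
  simp

theorem TreeWt.sum_inv (h : TreeWt T G t w k r) (v : α) :
    ∑ f, w f * (dgr G (f v))⁻¹ ≤ Fintype.card β := by
  rw [h.sum_fun v fun x => (dgr G x)⁻¹]
  calc _ ≤ ∑ x : β, (1 : ℝ) := Finset.sum_le_sum fun x _ => mul_inv_le_one
    _ = _ := by simp

end

theorem treeWt_zero {α β : Type} [Fintype α] [DecidableEq α] [Fintype β] (T : SimpleGraph α) (G : SimpleGraph β)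
    (hc : Fintype.card α = 1) : ∃ w k r, TreeWt T G 0 w k r := by
  classical
  obtain ⟨r, hr⟩ := Fintype.card_eq_one_iff.mp hc
  have : Unique α := ⟨⟨r⟩, hr⟩
  refine ⟨fun f => dgr G (f r), fun _ => 0, r, ?_, ?_, ?_, ?_, ?_, ?_, ?_⟩
  · intro f; exact dgr_nonneg _ _
  · intro f _ u v huv
    exact absurd (Subsingleton.elim u v) huv.ne
  · intro v x
    rw [← (Equiv.funUnique α β).symm.sum_comp]
    simp
  · intro f _; simp
  · simp
  · intro h; omega
  · simp [Function.injective_of_subsingleton]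

/-- Extend a map off `l` by the value `y` at `l`. -/
theorem sum_split {α β : Type} [Fintype α] [DecidableEq α] [Fintype β] (l : α)
    (H : (α → β) → ℝ) :
    ∑ f, H f = ∑ f' : {x // x ≠ l} → β, ∑ y : β, H ((Equiv.funSplitAt l β).symm (y, f')) := by
  rw [← (Equiv.funSplitAt l β).symm.sum_comp, Fintype.sum_prod_type_right]

theorem treeWt_succ {α β : Type} [Fintype α] [DecidableEq α] [Fintype β] (T : SimpleGraph α)
    (G : SimpleGraph β) (t : ℕ) (l : α) (p : {x // x ≠ l}) (hc : Fintype.card α = t + 2)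
    (hl : ∀ v, T.Adj l v → v = p)
    (w : ({x // x ≠ l} → β) → ℝ) (k : {x // x ≠ l} → ℕ) (r : {x // x ≠ l})
    (h : TreeWt (T.comap (Subtype.val : {x // x ≠ l} → α)) G t w k r) :
    ∃ w k r, TreeWt T G (t + 1) w k r := by
  classical
  have hcard : Fintype.card {x // x ≠ l} = t + 1 := by
    simp [Fintype.card_subtype_compl, hc]
  have e1 : ∀ y (f' : {x // x ≠ l} → β), (Equiv.funSplitAt l β).symm (y, f') l = y := by
    intro y f'; simp [Equiv.funSplitAt, Equiv.piSplitAt]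
  have e2 : ∀ y (f' : {x // x ≠ l} → β) (v : {x // x ≠ l}),
      (Equiv.funSplitAt l β).symm (y, f') v = f' v := by
    intro y f' v; simp [Equiv.funSplitAt, Equiv.piSplitAt, v.2]
  -- normalisation of the step
  have key : ∀ f' : {x // x ≠ l} → β,
      ∑ y, (if G.Adj (f' p) y then w f' * (dgr G (f' p))⁻¹ else 0) = w f' := by
    intro f'
    have : ∑ y, (if G.Adj (f' p) y then w f' * (dgr G (f' p))⁻¹ else 0)
        = dgr G (f' p) * (w f' * (dgr G (f' p))⁻¹) := by
      generalize w f' * (dgr G (f' p))⁻¹ = c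
      rw [dgr, Finset.sum_mul]
      exact Finset.sum_congr rfl fun y _ => by split_ifs <;> simp
    rw [this]
    by_cases hw : w f' = 0
    · simp [hw]
    · have := h.dgr_ne f' hw p
      field_simp
  set W : (α → β) → ℝ := fun f =>
    if G.Adj (f p) (f l) then w (fun v => f v) * (dgr G (f p))⁻¹ else 0 with hW
  have eW : ∀ y (f' : {x // x ≠ l} → β), W ((Equiv.funSplitAt l β).symm (y, f')) =
      if G.Adj (f' p) y then w f' * (dgr G (f' p))⁻¹ else 0 := by
    intro y f'
    simp only [hW, e1, e2]
  have hWne : ∀ f, W f ≠ 0 → G.Adj (f p) (f l) ∧ w (fun v => f v) ≠ 0 := by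
    intro f hf
    simp only [hW] at hf
    split_ifs at hf with ha
    · exact ⟨ha, fun h0 => hf (by simp [h0])⟩
    · exact absurd rfl hf
  have prodsplit : ∀ g : α → ℝ, ∏ v, g v = g l * ∏ v : {x // x ≠ l}, g v := by
    intro g
    rw [Fintype.prod_eq_mul_prod_subtype_ne]
  have sumsplit : ∀ g : α → ℕ, ∑ v, g v = g l + ∑ v : {x // x ≠ l}, g v := by
    intro g
    rw [Fintype.sum_eq_add_sum_subtype_ne]
  set K : α → ℕ := fun v => if hv : v ≠ l then k ⟨v, hv⟩ + (if v = p then 1 else 0) else 0 with hK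
  have K1 : K l = 0 := by simp [hK]
  have K2 : ∀ v : {x // x ≠ l}, K v = k v + if v = p then 1 else 0 := by
    intro v
    simp [hK, v.2, Subtype.ext_iff]
  refine ⟨W, K, r, ?_, ?_, ?_, ?_, ?_, ?_, ?_⟩
  · intro f
    simp only [hW]
    split_ifs
    · exact mul_nonneg (h.nonneg _) (inv_nonneg.mpr (dgr_nonneg _ _))
    · exact le_rfl
  · intro f hf u v huv
    obtain ⟨ha, hw⟩ := hWne f hf
    by_cases hu : u = l
    · subst hu
      rw [hl v huv]; exact ha.symm
    · by_cases hv : v = l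
      · subst hv
        rw [hl u huv.symm]; exact ha
      · exact h.hom _ hw ⟨u, hu⟩ ⟨v, hv⟩ huv
  · intro v x
    rw [sum_split l]
    simp only [eW]
    by_cases hv : v = l
    · subst hv
      simp only [e1, Finset.sum_ite_eq', Finset.mem_univ, if_true]
      have := h.sum_fun p (fun y => if G.Adj y x then (dgr G y)⁻¹ else 0)
      simp only [mul_ite, mul_zero] at this
      rw [this]
      rw [dgr]
      refine Finset.sum_congr rfl fun y _ => ?_
      by_cases ha : G.Adj y x
      · rw [if_pos ha, if_pos ha.symm, mul_inv_cancel₀]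
        intro h0
        have h1 : (1 : ℝ) ≤ dgr G y := by
          rw [dgr]
          refine le_trans ?_ (Finset.single_le_sum (a := x) (fun y _ => ?_) (Finset.mem_univ _))
          · simp [ha]
          · split_ifs <;> norm_num
        linarith
      · rw [if_neg ha, if_neg fun h' => ha h'.symm]
    · rw [← h.marg ⟨v, hv⟩ x]
      refine Finset.sum_congr rfl fun f' _ => ?_
      have e3 : ∀ y, (Equiv.funSplitAt l β).symm (y, f') v = f' ⟨v, hv⟩ := fun y => e2 y f' ⟨v, hv⟩
      simp only [e3]
      split_ifs
      · exact key f'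
      · simp
  · intro f hf
    obtain ⟨ha, hw⟩ := hWne f hf
    have hp := h.prod _ hw
    have hd := h.dgr_ne _ hw p
    rw [prodsplit, K1, pow_zero, one_mul]
    simp only [K2, pow_add, Finset.prod_mul_distrib, pow_ite, pow_one, pow_zero,
      Finset.prod_ite_eq', Finset.mem_univ, if_true]
    rw [← hp]
    simp only [hW, if_pos ha]
    field_simp
  · rw [sumsplit, K1]
    simp [K2, Finset.sum_add_distrib, h.ksum]
  · intro _
    rw [K2]
    rcases Nat.eq_zero_or_pos t with h0 | h0
    · have : Subsingleton {x // x ≠ l} := Fintype.card_le_one_iff_subsingleton.mp (by omega)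
      rw [if_pos (Subsingleton.elim _ _)]; omega
    · have := h.kroot h0
      omega
  · rw [sum_split l]
    have hb : ∀ f' : {x // x ≠ l} → β,
        ∑ y, (if Function.Injective ((Equiv.funSplitAt l β).symm (y, f')) then 0
          else W ((Equiv.funSplitAt l β).symm (y, f'))) ≤
        (if Function.Injective f' then 0 else w f') + t * (w f' * (dgr G (f' p))⁻¹) := by
      intro f'
      have hq : 0 ≤ w f' * (dgr G (f' p))⁻¹ :=
        mul_nonneg (h.nonneg _) (inv_nonneg.mpr (dgr_nonneg _ _))
      simp only [eW]
      by_cases hi : Function.Injective f'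
      · rw [if_pos hi, zero_add]
        have hcc : (((Finset.univ.erase p).image f').card : ℝ) ≤ t := by
          refine le_trans (Nat.cast_le.mpr Finset.card_image_le) ?_
          rw [Finset.card_erase_of_mem (Finset.mem_univ _), Finset.card_univ, hcard]
          simp
        calc _ ≤ ∑ y, (if y ∈ (Finset.univ.erase p).image f' then
                w f' * (dgr G (f' p))⁻¹ else 0) := by
              refine Finset.sum_le_sum fun y _ => ?_
              by_cases hy : y ∈ (Finset.univ.erase p).image f'
              · rw [if_pos hy]; split_ifs <;> first | exact le_rfl | exact hq
              · rw [if_neg hy]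
                split_ifs with h1 h2
                · exact le_rfl
                · exfalso
                  apply h1
                  have hy' : ∀ v, f' v ≠ y := by
                    intro v hv
                    by_cases hvp : v = p
                    · subst hvp; rw [hv] at h2; exact h2.ne rfl
                    · exact hy (Finset.mem_image.mpr ⟨v, by simp [hvp], hv⟩)
                  intro a b hab
                  by_cases hal : a = l
                  · by_cases hbl : b = l
                    · rw [hal, hbl]
                    · subst hal
                      rw [e1, e2 y f' ⟨b, hbl⟩] at hab
                      exact absurd hab.symm (hy' _)
                  · by_cases hbl : b = l
                    · subst hbl
                      rw [e1, e2 y f' ⟨a, hal⟩] at hab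
                      exact absurd hab (hy' _)
                    · rw [e2 y f' ⟨a, hal⟩, e2 y f' ⟨b, hbl⟩] at hab
                      exact congrArg Subtype.val (hi hab)
                · exact le_rfl
          _ = (((Finset.univ.erase p).image f').card : ℝ) * (w f' * (dgr G (f' p))⁻¹) := by
              rw [Finset.sum_ite_mem, Finset.univ_inter, Finset.sum_const, nsmul_eq_mul]
          _ ≤ _ := mul_le_mul_of_nonneg_right hcc hq
      · rw [if_neg hi]
        have h3 : 0 ≤ (t : ℝ) * (w f' * (dgr G (f' p))⁻¹) := mul_nonneg (Nat.cast_nonneg _) hq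
        refine le_trans ?_ (le_add_of_nonneg_right h3)
        rw [← key f']
        refine Finset.sum_le_sum fun y _ => ?_
        rw [key f']
        split_ifs <;> first | exact le_rfl | exact hq
    refine le_trans (Finset.sum_le_sum fun f' _ => hb f') ?_
    rw [Finset.sum_add_distrib, ← Finset.mul_sum]
    have h1 := h.ninj
    have h2 := h.sum_inv p
    have h3 := mul_le_mul_of_nonneg_left h2 (Nat.cast_nonneg (α := ℝ) t)
    have h4 : 0 ≤ (t : ℝ) * Fintype.card β := by positivity
    push_cast
    nlinarith

theorem treeWt_exists {β : Type} [Fintype β] (G : SimpleGraph β) (t : ℕ) :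
    ∀ (α : Type) [Fintype α] [DecidableEq α] (T : SimpleGraph α), T.IsTree → Fintype.card α = t + 1 →
      ∃ w k r, TreeWt T G t w k r := by
  classical
  induction t with
  | zero => intro α _ _ T _ hc; exact treeWt_zero T G hc
  | succ t ih =>
    intro α _ _ T hT hc
    have : Nontrivial α := Fintype.one_lt_card_iff_nontrivial.mp (by omega)
    obtain ⟨l, hl⟩ := hT.exists_vert_degree_one_of_nontrivial
    obtain ⟨p, hp, hu⟩ := SimpleGraph.degree_eq_one_iff_existsUnique_adj.mp hl
    have hT' : (T.comap (Subtype.val : {x // x ≠ l} → α)).IsTree :=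
      ⟨hT.1.induce_compl_singleton_of_degree_eq_one hl, hT.2.induce ({l}ᶜ : Set α)⟩
    obtain ⟨w, k, r, h⟩ := ih {x // x ≠ l} _ hT' (by simp [Fintype.card_subtype_compl, hc])
    exact treeWt_succ T G t l ⟨p, hp.ne'⟩ hc hu w k r h

theorem sum_dgr {β : Type} [Fintype β] (G : SimpleGraph β) :
    ∑ x, dgr G x = Fintype.card β * avgDeg G := by
  classical
  have h1 : ∀ x, dgr G x = G.degree x := by
    intro x
    rw [dgr, ← SimpleGraph.card_neighborFinset_eq_degree, SimpleGraph.neighborFinset_eq_filter]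
    simp
  simp_rw [h1]
  rw [← Nat.cast_sum, SimpleGraph.sum_degrees_eq_twice_card_edges, avgDeg]
  rw [Nat.card_eq_fintype_card, ← SimpleGraph.edgeFinset_card]
  rcases isEmpty_or_nonempty β with h | h
  · simp [Finset.eq_empty_of_isEmpty]
  · have : (Fintype.card β : ℝ) ≠ 0 := by exact_mod_cast Fintype.card_ne_zero
    push_cast
    field_simp

/-- Tangent-line form of the weighted AM-GM inequality. -/
theorem amgm_log {ι : Type} [Fintype ι] (a : ℝ) (ha : 0 < a) (b : ι → ℝ) (hb : ∀ i, 0 < b i)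
    (k : ι → ℕ) (h : a * ∏ i, b i ^ k i = 1) :
    1 + (∑ i, (k i : ℝ)) ≤ a + ∑ i, (k i : ℝ) * b i := by
  have h1 := congrArg Real.log h
  rw [Real.log_mul ha.ne' (Finset.prod_ne_zero_iff.mpr fun i _ => pow_ne_zero _ (hb i).ne'),
    Real.log_prod (fun i _ => pow_ne_zero _ (hb i).ne'), Real.log_one] at h1
  simp only [Real.log_pow] at h1
  have h2 := Real.log_le_sub_one_of_pos ha
  have h3 : ∑ i, (k i : ℝ) * Real.log (b i) ≤ ∑ i, ((k i : ℝ) * b i - k i) := by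
    refine Finset.sum_le_sum fun i _ => ?_
    have := mul_le_mul_of_nonneg_left (Real.log_le_sub_one_of_pos (hb i))
      (Nat.cast_nonneg (α := ℝ) (k i))
    linarith
  rw [Finset.sum_sub_distrib] at h3
  linarith

/-- Appendix bound: if `T` is a tree with `t` edges and `G` has average degree
`d ≥ t(t-1)`, then `|Mon(T,G)| ≥ n·(d - t(t-1))^t`. -/
theorem tree_count_appendix_bound (t : ℕ) (ht : 1 ≤ t)
    (α β : Type) [Fintype α] [Fintype β]
    (T : SimpleGraph α) (G : SimpleGraph β)
    (hT : T.IsTree) (hcard : Fintype.card α = t + 1)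
    (hd : (t : ℝ) * ((t : ℝ) - 1) ≤ avgDeg G) :
    (Fintype.card β : ℝ) * (avgDeg G - (t : ℝ) * ((t : ℝ) - 1)) ^ t ≤ (monCount T G : ℝ) := by
  classical
  rcases hd.eq_or_lt with h0 | hpos
  · rw [← h0, sub_self, zero_pow (by omega), mul_zero]; positivity
  obtain ⟨w, k, r, h⟩ := treeWt_exists G t α T hT hcard
  set D := avgDeg G - (t : ℝ) * ((t : ℝ) - 1) with hD
  have hDpos : 0 < D := by linarith
  set n : ℝ := (Fintype.card β : ℝ) with hn
  set X : Finset (α → β) := Finset.univ.filter fun f =>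
    Function.Injective f ∧ ∀ ⦃u v : α⦄, T.Adj u v → G.Adj (f u) (f v) with hX
  have hmon : (monCount T G : ℝ) = X.card := by
    rw [monCount, Nat.card_eq_fintype_card, Fintype.card_subtype]
  rw [hmon]
  obtain ⟨s, rfl⟩ : ∃ s, t = s + 1 := ⟨t - 1, by omega⟩
  -- total mass
  have htot : ∑ f, w f = n * avgDeg G := by
    rw [← sum_dgr]
    simpa using h.sum_fun r (fun _ => 1)
  have hS : n * D ≤ ∑ f ∈ X, w f := by
    have e : ∑ f, w f = ∑ f ∈ X, w f + ∑ f, (if Function.Injective f then 0 else w f) := by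
      rw [hX, Finset.sum_filter, ← Finset.sum_add_distrib]
      refine Finset.sum_congr rfl fun f _ => ?_
      by_cases hw : w f = 0
      · simp [hw]
      · have := h.hom f hw
        by_cases hi : Function.Injective f
        · rw [if_pos ⟨hi, fun u v => this u v⟩, if_pos hi, add_zero]
        · rw [if_neg fun h' => hi h'.1, if_neg hi, zero_add]
    have := h.ninj
    rw [hD, mul_sub]
    linarith
  -- reduced exponents
  set k' : α → ℕ := fun v => if v = r then k v - 1 else k v with hk'
  have hkk : ∀ v, k v = k' v + if v = r then 1 else 0 := by
    intro v
    have := h.kroot (by omega)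
    simp only [hk']
    split_ifs with hv
    · subst hv; omega
    · rfl
  have hsum : ∑ v, k' v = s := by
    have := h.ksum
    simp only [hkk, Finset.sum_add_distrib, Finset.sum_ite_eq', Finset.mem_univ, if_true] at this
    omega
  have hsumR : ∑ v, (k' v : ℝ) = s := by exact_mod_cast hsum
  have hpt : ∀ f, (s + 1 : ℝ) * w f ≤
      (D ^ s)⁻¹ + ∑ v, (k' v : ℝ) * D * (w f * (dgr G (f v))⁻¹) := by
    intro f
    by_cases hw : w f = 0
    · simp only [hw, mul_zero, zero_mul, Finset.sum_const_zero, add_zero]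
      positivity
    · have hwp : 0 < w f := lt_of_le_of_ne (h.nonneg f) (Ne.symm hw)
      have hdp : ∀ v, 0 < dgr G (f v) := fun v =>
        lt_of_le_of_ne (dgr_nonneg _ _) (Ne.symm (h.dgr_ne f hw v))
      have hp := h.prod f hw
      simp only [hkk, pow_add, Finset.prod_mul_distrib, pow_ite, pow_one, pow_zero,
        Finset.prod_ite_eq', Finset.mem_univ, if_true] at hp
      have hp' : w f * ∏ v, dgr G (f v) ^ k' v = 1 := by
        rw [← mul_assoc] at hp
        exact (mul_eq_right₀ (hdp r).ne').mp hp
      have hprodpos : 0 < ∏ v, dgr G (f v) ^ k' v :=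
        Finset.prod_pos fun v _ => pow_pos (hdp v) _
      have := amgm_log ((D ^ s)⁻¹ * (w f)⁻¹) (by positivity) (fun v => D * (dgr G (f v))⁻¹)
        (fun v => mul_pos hDpos (inv_pos.mpr (hdp v))) k' (by
          simp only [mul_pow, Finset.prod_mul_distrib, inv_pow, Finset.prod_inv_distrib]
          rw [Finset.prod_pow_eq_pow_sum, hsum]
          have h5 : (∏ v, dgr G (f v) ^ k' v)⁻¹ = w f := (eq_inv_of_mul_eq_one_left hp').symm
          rw [h5]
          field_simp)
      rw [hsumR] at this
      have h6 := mul_le_mul_of_nonneg_left this hwp.le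
      rw [mul_add (w f) ((D ^ s)⁻¹ * (w f)⁻¹), Finset.mul_sum] at h6
      calc _ = w f * (1 + s) := by ring
        _ ≤ _ := h6
        _ = _ := by
          congr 1
          · field_simp
          · exact Finset.sum_congr rfl fun v _ => by ring
  have hfin : (s + 1 : ℝ) * ∑ f ∈ X, w f ≤ X.card * (D ^ s)⁻¹ + s * D * n := by
    rw [Finset.mul_sum]
    refine le_trans (Finset.sum_le_sum fun f _ => hpt f) ?_
    rw [Finset.sum_add_distrib, Finset.sum_const, nsmul_eq_mul, Finset.sum_comm]
    gcongr
    rw [← hsumR, Finset.sum_mul, Finset.sum_mul]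
    refine Finset.sum_le_sum fun v _ => ?_
    rw [← Finset.mul_sum]
    refine mul_le_mul_of_nonneg_left ?_ (by positivity)
    refine le_trans ?_ (h.sum_inv v)
    exact Finset.sum_le_sum_of_subset_of_nonneg (Finset.subset_univ _) fun f _ _ =>
      mul_nonneg (h.nonneg f) (inv_nonneg.mpr (dgr_nonneg _ _))
  have h7 : n * D ≤ X.card * (D ^ s)⁻¹ := by
    have := mul_le_mul_of_nonneg_left hS (by positivity : (0 : ℝ) ≤ s + 1)
    nlinarith
  have hDs : 0 < D ^ s := pow_pos hDpos s
  rw [← div_eq_mul_inv, le_div_iff₀ hDs] at h7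
  calc n * D ^ (s + 1) = n * D * D ^ s := by ring
    _ ≤ _ := h7
end
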